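/- Let k ≥ 3 and let F(x,y) = n₁y^k − n₂x^k with n₁, n₂ nonzero integers such that F has nonzero discriminant. For Z > 0, the number of integer pairs (x,y) with 0 < |F(x,y)| ≤ Z and max{|x|,|y|} > Z^γ, where γ > 1/k, is O_F(Z^{1/k}·log Z + Z^{1−(k−2)γ}). -/

import Mathlib

open Finset in
lemma sx_factorial_dvd (k m : ℕ) (e c : ℤ) :
    ((m.factorial : ℕ) : ℤ) ∣ (k : ℤ) ^ m * ∏ i ∈ range m, ((k : ℤ) * (e + i) + c) := by
  rw [Int.natCast_dvd]
  rw [Nat.dvd_iff_prime_pow_dvd_dvd]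
  intro p v hp hv
  rw [← Int.natCast_dvd]
  by_cases hpk : p ∣ k
  · have hvm : v ≤ m := by
      rcases Nat.eq_zero_or_pos m with rfl | hm
      · simp only [Nat.factorial_zero, Nat.dvd_one] at hv
        rcases Nat.pow_eq_one.mp hv with h | h
        · exact absurd h hp.one_lt.ne'
        · omega
      · have := Fact.mk hp
        have h1 := (padicValNat_dvd_iff_le (Nat.factorial_ne_zero m)).mp hv
        have h2 := padicValNat_factorial_lt_of_ne_zero (p := p) (n := m) (by omega)
        omega
    apply Dvd.dvd.mul_right
    have h3 : p ^ v ∣ k ^ m := (pow_dvd_pow p hvm).trans (pow_dvd_pow_of_dvd hpk m)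
    exact_mod_cast h3
  · apply Dvd.dvd.mul_left
    have hcop : IsCoprime (k : ℤ) ((p ^ v : ℕ) : ℤ) := by
      rw [Nat.isCoprime_iff_coprime]
      exact (((Nat.Prime.coprime_iff_not_dvd hp).mpr hpk).pow_left v).symm
    obtain ⟨a, b, hab⟩ := hcop
    have h1 : ((p ^ v : ℕ) : ℤ) ∣ (k : ℤ) ^ m * ∏ i ∈ range m, ((e + c * a) + i) :=
      Dvd.dvd.mul_left ((Int.natCast_dvd_natCast.mpr hv).trans (Nat.factorial_coe_dvd_prod m _)) _
    have h2 : (∏ i ∈ range m, ((k : ℤ) * (e + i) + c)) ≡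
        (k : ℤ) ^ m * ∏ i ∈ range m, ((e + c * a) + i) [ZMOD ((p ^ v : ℕ) : ℤ)] := by
      have : (k : ℤ) ^ m * ∏ i ∈ range m, ((e + c * a) + i) =
          ∏ i ∈ range m, ((k : ℤ) * ((e + c * a) + i)) := by
        rw [prod_mul_distrib]; simp
      rw [this]
      refine Int.ModEq.prod (fun i _ => ?_)
      rw [Int.modEq_iff_dvd]
      refine ⟨-(c * b), ?_⟩
      linear_combination c * hab
    exact Int.dvd_of_emod_eq_zero (Eq.trans h2 (Int.emod_eq_zero_of_dvd h1))

/-- integral building block of the Pade coefficients -/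
def sxE (k : ℕ) (c : ℤ) (j m : ℕ) : ℤ :=
  ((k : ℤ) ^ m * ∏ i ∈ Finset.range m, ((k : ℤ) * ((j + 1 : ℕ) + i) + c)) / (m.factorial : ℕ)

lemma sxE_mul (k : ℕ) (c : ℤ) (j m : ℕ) : ((m.factorial : ℕ) : ℤ) * sxE k c j m =
    (k : ℤ) ^ m * ∏ i ∈ Finset.range m, ((k : ℤ) * ((j + 1 : ℕ) + i) + c) :=
  Int.mul_ediv_cancel' (sx_factorial_dvd k m _ c)

/-- Pade coefficient -/
def sxB (k n j : ℕ) : ℤ := sxE k 1 j (n - j) * sxE k (-1) (n - j) j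

open Finset in
lemma sxE_nonneg (k : ℕ) (hk : 1 ≤ k) (c : ℤ) (hc : -1 ≤ c) (j m : ℕ) : 0 ≤ sxE k c j m := by
  unfold sxE
  apply Int.ediv_nonneg _ (by positivity)
  apply mul_nonneg (by positivity)
  apply prod_nonneg
  intro i _
  have : (1 : ℤ) ≤ k := by exact_mod_cast hk
  push_cast
  nlinarith [mul_nonneg (by linarith : (0:ℤ) ≤ (k:ℤ) - 1) (by positivity : (0:ℤ) ≤ (j:ℤ) + 1 + i)]

open Finset in
lemma sxE_le (k : ℕ) (hk : 1 ≤ k) (c : ℤ) (hc : -1 ≤ c) (hc1 : c ≤ 1) (j m : ℕ) :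
    sxE k c j m ≤ k ^ (2 * m) * 2 ^ (j + m + 1) := by
  have hf : (0 : ℤ) < ((m.factorial : ℕ) : ℤ) := by exact_mod_cast m.factorial_pos
  refine le_of_mul_le_mul_left ?_ hf
  rw [sxE_mul]
  have hk' : (1 : ℤ) ≤ k := by exact_mod_cast hk
  have h1 : ∏ i ∈ range m, ((k : ℤ) * ((j + 1 : ℕ) + i) + c) ≤
      ∏ i ∈ range m, ((k : ℤ) * ((j + 2 + i : ℕ))) := by
    apply prod_le_prod
    · intro i _
      push_cast
      nlinarith [mul_nonneg (by linarith : (0:ℤ) ≤ (k:ℤ) - 1) (by positivity : (0:ℤ) ≤ (j:ℤ) + 1 + i)]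
    · intro i _
      push_cast
      nlinarith
  have h2 : ∏ i ∈ range m, ((k : ℤ) * ((j + 2 + i : ℕ))) = k ^ m * ((m.factorial * (j + 1 + m).choose m : ℕ) : ℤ) := by
    rw [prod_mul_distrib, ← Nat.ascFactorial_eq_factorial_mul_choose, Nat.ascFactorial_eq_prod_range]
    simp [add_assoc]
  have h3 : (((j + 1 + m).choose m : ℕ) : ℤ) ≤ 2 ^ (j + m + 1) := by
    have := Nat.choose_le_two_pow (j + 1 + m) m
    rw [show j + 1 + m = j + m + 1 by ring] at *
    exact_mod_cast this
  calc (k : ℤ) ^ m * ∏ i ∈ range m, ((k : ℤ) * ((j + 1 : ℕ) + i) + c)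
      ≤ k ^ m * (k ^ m * ((m.factorial * (j + 1 + m).choose m : ℕ) : ℤ)) := by
        rw [← h2]; gcongr
    _ = m.factorial * (k ^ (2 * m) * (j + 1 + m).choose m) := by push_cast; ring
    _ ≤ _ := by gcongr

lemma sxB_nonneg (k n j : ℕ) (hk : 1 ≤ k) : 0 ≤ sxB k n j :=
  mul_nonneg (sxE_nonneg k hk _ (by norm_num) _ _) (sxE_nonneg k hk _ (by norm_num) _ _)

lemma sxB_le (k n j : ℕ) (hk : 1 ≤ k) (hj : j ≤ n) : sxB k n j ≤ (4 * k ^ 2) ^ (n + 1) := by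
  have h1 := sxE_le k hk 1 (by norm_num) (by norm_num) j (n - j)
  have h2 := sxE_le k hk (-1) (by norm_num) (by norm_num) (n - j) j
  have hk' : (1 : ℤ) ≤ k := by exact_mod_cast hk
  obtain ⟨r, rfl⟩ := Nat.exists_eq_add_of_le hj
  have e : j + r - j = r := by omega
  unfold sxB
  rw [e] at h1 h2 ⊢
  calc _ ≤ ((k:ℤ) ^ (2 * r) * 2 ^ (j + r + 1)) * (k ^ (2 * j) * 2 ^ (r + j + 1)) :=
        mul_le_mul h1 h2 (sxE_nonneg k hk _ (by norm_num) _ _) (by positivity)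
    _ = (4 ^ (j + r + 1)) * (k ^ 2) ^ (j + r) := by
        rw [show (4:ℤ) = 2 * 2 by norm_num, mul_pow]; ring
    _ ≤ (4 ^ (j + r + 1)) * (k ^ 2) ^ (j + r + 1) := by
        have h5 : (k ^ 2 : ℤ) ^ (j + r) ≤ (k ^ 2) ^ (j + r + 1) :=
          pow_le_pow_right₀ (by nlinarith) (Nat.le_succ _)
        gcongr
    _ = _ := by rw [mul_pow]

open Finset in
lemma sx_prod_erase (j r : ℕ) (g : ℕ → ℝ) :
    ∏ l ∈ (range (j + r + 1)).erase j, g l =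
      (∏ i ∈ range j, g (j - 1 - i)) * ∏ i ∈ range r, g (j + 1 + i) := by
  have h : ∏ l ∈ (range (j + r + 1)).erase j, g l =
      ∏ l ∈ (range (j + r + 1)), Function.update g j 1 l := by
    rw [← prod_erase (range (j + r + 1)) (a := j) (by simp)]
    apply prod_congr rfl
    intro l hl
    rw [Function.update_of_ne (ne_of_mem_erase hl)]
  rw [h, show j + r + 1 = j + 1 + r by ring, prod_range_add, prod_range_succ, prod_range_reflect]
  simp only [Function.update_self, mul_one]
  congr 1
  · apply prod_congr rfl
    intro l hl
    rw [Function.update_of_ne (by have := mem_range.mp hl; omega)]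
  · apply prod_congr rfl
    intro l hl
    rw [Function.update_of_ne (by omega)]

open Finset in
lemma sx_prod_all (j r : ℕ) (g : ℕ → ℝ) :
    ∏ l ∈ (range (j + r + 1)), g l =
      (∏ i ∈ range j, g (j - 1 - i)) * g j * ∏ i ∈ range r, g (j + 1 + i) := by
  rw [show j + r + 1 = j + 1 + r by ring, prod_range_add, prod_range_succ, prod_range_reflect]

/-- the partial products -/
noncomputable def sxP (k : ℕ) (c : ℝ) (m : ℕ) : ℝ := ∏ i ∈ Finset.range m, ((k : ℝ) * (i + 1) + c)

open Finset in
lemma sxE_real (k : ℕ) (c : ℤ) (j m : ℕ) :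
    (m.factorial : ℝ) * (sxE k c j m : ℝ) * sxP k c j = (k : ℝ) ^ m * sxP k c (j + m) := by
  have h := congrArg (Int.cast : ℤ → ℝ) (sxE_mul k c j m)
  push_cast at h
  rw [h]
  unfold sxP
  rw [prod_range_add]
  push_cast
  have : ∀ x : ℕ, (j : ℝ) + x + 1 = j + 1 + x := fun x => by ring
  simp only [this]
  ring

lemma sxP_ne (k : ℕ) (hk : 2 ≤ k) (c : ℝ) (hc : -1 ≤ c) (m : ℕ) : sxP k c m ≠ 0 := by
  unfold sxP
  rw [Finset.prod_ne_zero_iff]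
  intro i _
  have : (2 : ℝ) ≤ k := by exact_mod_cast hk
  have : (0:ℝ) ≤ i := by positivity
  nlinarith

lemma sx_prodfac (k r : ℕ) : ∏ i ∈ Finset.range r, ((k : ℝ) * (i + 1)) = k ^ r * r.factorial := by
  induction r with
  | zero => simp
  | succ n ih => rw [Finset.prod_range_succ, ih, Nat.factorial_succ]; push_cast; ring

open Finset in
lemma sx_node0 (k j r : ℕ) :
    (∏ l ∈ (range (j + r + 1)).erase j, ((k : ℝ) * j - k * l)) *
      ∏ l ∈ range (j + r + 1), ((k : ℝ) * j - (k * l + 1)) =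
    - (k ^ (j + r) * j.factorial * r.factorial * sxP k (-1) j * sxP k 1 r) := by
  rw [sx_prod_erase, sx_prod_all]
  have h1 : ∏ i ∈ range j, ((k : ℝ) * j - k * (j - 1 - i : ℕ)) = k ^ j * j.factorial := by
    rw [← sx_prodfac]
    apply prod_congr rfl
    intro i hi
    have := mem_range.mp hi
    rw [Nat.sub_sub, Nat.cast_sub (by omega)]
    push_cast; ring
  have h2 : ∏ i ∈ range r, ((k : ℝ) * j - k * (j + 1 + i : ℕ)) = (-1) ^ r * (k ^ r * r.factorial) := by
    rw [← sx_prodfac, ← card_range r, ← prod_const, card_range, ← prod_mul_distrib]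
    apply prod_congr rfl
    intro i hi
    push_cast; ring
  have h3 : ∏ i ∈ range j, ((k : ℝ) * j - (k * (j - 1 - i : ℕ) + 1)) = sxP k (-1) j := by
    apply prod_congr rfl
    intro i hi
    have := mem_range.mp hi
    rw [Nat.sub_sub, Nat.cast_sub (by omega)]
    push_cast; ring
  have h4 : ∏ i ∈ range r, ((k : ℝ) * j - (k * (j + 1 + i : ℕ) + 1)) = (-1) ^ r * sxP k 1 r := by
    unfold sxP
    rw [← card_range r, ← prod_const, card_range, ← prod_mul_distrib]
    apply prod_congr rfl
    intro i hi
    push_cast; ring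
  rw [h1, h2, h3, h4]
  have : ((-1 : ℝ) ^ r) * (-1) ^ r = 1 := by rw [← mul_pow]; simp
  rw [pow_add]
  linear_combination (-(k:ℝ)^j * j.factorial * k^r * r.factorial * sxP k (-1) j * sxP k 1 r) * this

open Finset in
lemma sx_node1 (k j r : ℕ) :
    (∏ l ∈ range (j + r + 1), ((k : ℝ) * j + 1 - k * l)) *
    (∏ l ∈ (range (j + r + 1)).erase j, ((k : ℝ) * j + 1 - (k * l + 1))) =
    (k ^ (j + r) * j.factorial * r.factorial * sxP k 1 j * sxP k (-1) r) := by
  rw [sx_prod_erase, sx_prod_all]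
  have h1 : ∏ i ∈ range j, ((k : ℝ) * j + 1 - (k * (j - 1 - i : ℕ) + 1)) = k ^ j * j.factorial := by
    rw [← sx_prodfac]
    apply prod_congr rfl
    intro i hi
    have := mem_range.mp hi
    rw [Nat.sub_sub, Nat.cast_sub (by omega)]
    push_cast; ring
  have h2 : ∏ i ∈ range r, ((k : ℝ) * j + 1 - (k * (j + 1 + i : ℕ) + 1)) = (-1) ^ r * (k ^ r * r.factorial) := by
    rw [← sx_prodfac, ← card_range r, ← prod_const, card_range, ← prod_mul_distrib]
    apply prod_congr rfl
    intro i hi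
    push_cast; ring
  have h3 : ∏ i ∈ range j, ((k : ℝ) * j + 1 - (k * (j - 1 - i : ℕ))) = sxP k 1 j := by
    apply prod_congr rfl
    intro i hi
    have := mem_range.mp hi
    rw [Nat.sub_sub, Nat.cast_sub (by omega)]
    push_cast; ring
  have h4 : ∏ i ∈ range r, ((k : ℝ) * j + 1 - (k * (j + 1 + i : ℕ))) = (-1) ^ r * sxP k (-1) r := by
    unfold sxP
    rw [← card_range r, ← prod_const, card_range, ← prod_mul_distrib]
    apply prod_congr rfl
    intro i hi
    push_cast; ring
  rw [h1, h2, h3, h4]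
  have : ((-1 : ℝ) ^ r) * (-1) ^ r = 1 := by rw [← mul_pow]; simp
  rw [pow_add]
  linear_combination ((k:ℝ)^j * j.factorial * k^r * r.factorial * sxP k (-1) r * sxP k 1 j) * this

open Finset Polynomial in
lemma sx_moments (k n : ℕ) (hk : 2 ≤ k) (P : ℝ[X]) (hP : P.natDegree ≤ 2 * n) :
    ∑ j ∈ range (n + 1), ((sxB k n j : ℝ) * P.eval ((k : ℝ) * j + 1)
      - (sxB k n (n - j) : ℝ) * P.eval ((k : ℝ) * j)) = 0 := by
  let s : Finset (ℕ ⊕ ℕ) := (range (n + 1)).disjSum (range (n + 1))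
  let v : ℕ ⊕ ℕ → ℝ := Sum.elim (fun j => (k : ℝ) * j) (fun j => (k : ℝ) * j + 1)
  have hs : #s = 2 * n + 2 := by simp [s]; ring
  have hinj : Function.Injective v := by
    rintro (a | a) (b | b) h
    · simp [v] at h; rcases h with h | h
      · rw [h]
      · omega
    · exfalso
      have h' : k * a = k * b + 1 := by simp only [v, Sum.elim_inl, Sum.elim_inr] at h; exact_mod_cast h
      have : k ∣ 1 := (Nat.dvd_add_right (Dvd.intro b rfl)).mp (h' ▸ Dvd.intro a rfl)
      have := Nat.dvd_one.mp this; omega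
    · exfalso
      have h' : k * b = k * a + 1 := by simp only [v, Sum.elim_inl, Sum.elim_inr] at h; exact_mod_cast h.symm
      have : k ∣ 1 := (Nat.dvd_add_right (Dvd.intro a rfl)).mp (h' ▸ Dvd.intro b rfl)
      have := Nat.dvd_one.mp this; omega
    · simp [v] at h; rcases h with h | h
      · rw [h]
      · omega
  have hdeg : P.degree < #s := by
    rw [hs]
    refine lt_of_le_of_lt degree_le_natDegree ?_
    exact_mod_cast (by omega : P.natDegree < 2 * n + 2)
  have key := Lagrange.coeff_eq_sum (s := s) (v := v) (hinj.injOn) hdeg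
  rw [hs, coeff_eq_zero_of_natDegree_lt (by omega), sum_disjSum] at key
  have e0 : ∀ j, s.erase (Sum.inl j) = ((range (n + 1)).erase j).disjSum (range (n + 1)) := by
    intro j; ext (x | x) <;> simp [s]
  have e1 : ∀ j, s.erase (Sum.inr j) = (range (n + 1)).disjSum ((range (n + 1)).erase j) := by
    intro j; ext (x | x) <;> simp [s]
  simp only [e0, e1, prod_disjSum] at key
  simp only [v, Sum.elim_inl, Sum.elim_inr] at key
  set T : ℝ := (k : ℝ) ^ n * k ^ n * sxP k 1 n * sxP k (-1) n with hT
  rw [← sum_add_distrib] at key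
  have := congrArg (fun z => T * z) key
  simp only [mul_zero, mul_sum] at this
  rw [this]
  apply sum_congr rfl
  intro j hj
  obtain ⟨r, hr⟩ := Nat.exists_eq_add_of_le (Nat.lt_succ_iff.mp (mem_range.mp hj))
  subst hr
  rw [sx_node0, sx_node1]
  have e : j + r - j = r := by omega
  have e' : j + r - r = j := by omega
  have a1 := sxE_real k 1 j r
  have a2 := sxE_real k (-1) r j
  have a3 := sxE_real k 1 r j
  have a4 := sxE_real k (-1) j r
  unfold sxB
  rw [e, e']
  rw [add_comm r j] at a2 a3
  push_cast at a1 a2 a3 a4 ⊢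
  have p1 := sxP_ne k hk 1 (by norm_num) j
  have p2 := sxP_ne k hk 1 (by norm_num) r
  have p3 := sxP_ne k hk (-1) (by norm_num) j
  have p4 := sxP_ne k hk (-1) (by norm_num) r
  have f1 : (j.factorial : ℝ) ≠ 0 := by positivity
  have f2 : (r.factorial : ℝ) ≠ 0 := by positivity
  have hk0 : (k : ℝ) ≠ 0 := by positivity
  have q1 : T = (k ^ (j + r) * j.factorial * r.factorial * sxP k 1 j * sxP k (-1) r) * ((sxE k 1 j r : ℝ) * sxE k (-1) r j) := by
    calc T = (k : ℝ) ^ (j + r) * ((k : ℝ) ^ r * sxP k 1 (j + r)) * ((k : ℝ) ^ j * sxP k (-1) (j + r)) := by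
          rw [hT]; ring
      _ = _ := by rw [← a1, ← a2]; ring
  have q2 : T = (k ^ (j + r) * j.factorial * r.factorial * sxP k (-1) j * sxP k 1 r) * ((sxE k 1 r j : ℝ) * sxE k (-1) j r) := by
    calc T = (k : ℝ) ^ (j + r) * ((k : ℝ) ^ j * sxP k 1 (j + r)) * ((k : ℝ) ^ r * sxP k (-1) (j + r)) := by
          rw [hT]; ring
      _ = _ := by rw [← a3, ← a4]; ring
  rw [mul_add]
  nth_rewrite 1 [q2]
  rw [q1]
  have d1 : (k ^ (j + r) * j.factorial * r.factorial * sxP k 1 j * sxP k (-1) r) ≠ 0 := by positivity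
  have d2 : (k ^ (j + r) * j.factorial * r.factorial * sxP k (-1) j * sxP k 1 r) ≠ 0 := by positivity
  field_simp
  ring

open Polynomial in
/-- Pade denominators as polynomials -/
noncomputable def sxPB (k n : ℕ) : ℝ[X] := ∑ j ∈ Finset.range (n + 1), C (sxB k n j : ℝ) * X ^ j

open Polynomial in
/-- Pade numerators as polynomials -/
noncomputable def sxPA (k n : ℕ) : ℝ[X] :=
  ∑ j ∈ Finset.range (n + 1), C (sxB k n (n - j) : ℝ) * X ^ j

/-- Taylor coefficients of the remainder -/
noncomputable def sxTau (k n m : ℕ) : ℝ :=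
  ∑ j ∈ Finset.range (n + 1), ((sxB k n j : ℝ) * ((k * j + 1).choose m : ℝ)
      - (sxB k n (n - j) : ℝ) * ((k * j).choose m : ℝ))

open Finset Polynomial in
lemma sxTau_zero (k n m : ℕ) (hk : 2 ≤ k) (hm : m ≤ 2 * n) : sxTau k n m = 0 := by
  have h := sx_moments k n hk (C ((m.factorial : ℝ)⁻¹) * descPochhammer ℝ m)
    ((natDegree_C_mul_le _ _).trans (by rw [descPochhammer_natDegree]; exact hm))
  have h2 : ∀ t : ℕ, eval (t : ℝ) (C ((m.factorial : ℝ)⁻¹) * descPochhammer ℝ m) = (t.choose m : ℝ) := by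
    intro t
    rw [eval_mul, eval_C, Nat.cast_choose_eq_descPochhammer_div]
    field_simp
  rw [← h]
  unfold sxTau
  apply sum_congr rfl
  intro j _
  rw [← h2, ← h2]
  push_cast
  rfl

open Finset in
lemma sx_pow_expand {R : Type*} [CommRing R] (u : R) (t N : ℕ) (h : t < N) :
    u ^ t = ∑ m ∈ range N, (t.choose m : R) * (u - 1) ^ m := by
  have h1 : u ^ t = ((u - 1) + 1) ^ t := by ring
  rw [h1, add_pow]
  simp only [one_pow, mul_one]
  rw [← sum_subset (range_subset_range.mpr (by omega : t + 1 ≤ N))]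
  · apply sum_congr rfl
    intro i _
    ring
  · intro x _ hx
    rw [Nat.choose_eq_zero_of_lt (by simpa using hx)]
    simp

open Polynomial in
/-- the cofactor polynomial -/
noncomputable def sxR (k n : ℕ) : ℝ[X] :=
  ∑ m ∈ Finset.range (k * n + 2), C (sxTau k n (2 * n + 1 + m)) * (X - 1) ^ m

open Finset Polynomial in
lemma sx_pade_poly (k n : ℕ) (hk : 2 ≤ k) :
    X * (sxPB k n).comp (X ^ k) - (sxPA k n).comp (X ^ k) = (X - 1) ^ (2 * n + 1) * sxR k n := by
  have h1 : X * (sxPB k n).comp (X ^ k) - (sxPA k n).comp (X ^ k) =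
      ∑ m ∈ range (2 * n + 1 + (k * n + 2)), C (sxTau k n m) * (X - 1) ^ m := by
    unfold sxPB sxPA sxTau
    simp only [Polynomial.sum_comp, mul_comp, C_comp, X_pow_comp, mul_sum, map_sum, sum_mul]
    rw [sum_comm, ← sum_sub_distrib]
    apply sum_congr rfl
    intro j hj
    have hj' : j ≤ n := Nat.lt_succ_iff.mp (mem_range.mp hj)
    have hkj : k * j ≤ k * n := Nat.mul_le_mul_left k hj'
    have e1 := sx_pow_expand (X : ℝ[X]) (k * j + 1) (2 * n + 1 + (k * n + 2)) (by omega)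
    have e2 := sx_pow_expand (X : ℝ[X]) (k * j) (2 * n + 1 + (k * n + 2)) (by omega)
    calc X * (C (sxB k n j : ℝ) * (X ^ k) ^ j) - C (sxB k n (n - j) : ℝ) * (X ^ k) ^ j
        = C (sxB k n j : ℝ) * X ^ (k * j + 1) - C (sxB k n (n - j) : ℝ) * X ^ (k * j) := by ring
      _ = _ := by
        rw [e1, e2, mul_sum, mul_sum, ← sum_sub_distrib]
        apply sum_congr rfl
        intro m _
        simp only [map_sub, map_mul, map_natCast]
        ring
  rw [h1, sum_range_add]
  have h2 : ∑ m ∈ range (2 * n + 1), C (sxTau k n m) * (X - 1 : ℝ[X]) ^ m = 0 := by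
    apply sum_eq_zero
    intro m hm
    rw [sxTau_zero k n m hk (by have := mem_range.mp hm; omega)]
    simp
  rw [h2, zero_add]
  unfold sxR
  rw [mul_sum]
  apply sum_congr rfl
  intro m _
  rw [pow_add]; ring

/-- the constant -/
noncomputable def sxK (k : ℕ) : ℝ := (4 * (k : ℝ) ^ 2) * (2 * 2 ^ (k + 1))

lemma sxB_cast_le (k n j : ℕ) (hk : 1 ≤ k) (hj : j ≤ n) :
    (sxB k n j : ℝ) ≤ (4 * (k : ℝ) ^ 2) ^ (n + 1) := by
  have := sxB_le k n j hk hj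
  exact_mod_cast this

lemma sxB_le_K (k n j : ℕ) (hk : 1 ≤ k) (hj : j ≤ n) :
    (sxB k n j : ℝ) ≤ sxK k ^ (n + 1) := by
  refine (sxB_cast_le k n j hk hj).trans ?_
  unfold sxK
  apply pow_le_pow_left₀ (by positivity)
  have : (1:ℝ) ≤ 2 ^ (k + 1) := one_le_pow₀ (by norm_num)
  have h2 : 0 ≤ (4 * (k : ℝ) ^ 2) := by positivity
  nlinarith

open Finset Polynomial in
lemma sxR_bound (k n : ℕ) (hk : 2 ≤ k) (u : ℝ) (hu : |u - 1| ≤ 1) :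
    |(sxR k n).eval u| ≤ sxK k ^ (n + 1) := by
  unfold sxR
  rw [eval_finsetSum]
  have hb0 : ∀ j, (0:ℝ) ≤ sxB k n j := fun j => by exact_mod_cast sxB_nonneg k n j (by omega)
  set c := (4 * (k : ℝ) ^ 2) ^ (n + 1) with hc
  have hc0 : 0 ≤ c := by positivity
  have hch : ∀ t ≤ k * n + 1, ∑ m ∈ range (k * n + 2), (t.choose (2 * n + 1 + m) : ℝ) ≤ 2 ^ (k * n + 1) := by
    intro t ht
    have h1 : ∑ m ∈ range (k * n + 2), t.choose (2 * n + 1 + m) ≤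
        ∑ m ∈ range (2 * n + 1 + (k * n + 2)), t.choose m := by
      rw [sum_range_add _ (2 * n + 1) (k * n + 2)]; exact Nat.le_add_left _ _
    have h2 : ∑ m ∈ range (2 * n + 1 + (k * n + 2)), t.choose m = 2 ^ t := by
      rw [← Nat.sum_range_choose]
      symm
      apply sum_subset (range_subset_range.mpr (by omega))
      intro x _ hx
      exact Nat.choose_eq_zero_of_lt (by simpa using hx)
    have h3 : (2:ℕ) ^ t ≤ 2 ^ (k * n + 1) := Nat.pow_le_pow_right (by norm_num) ht
    have := h1.trans (h2.le.trans h3)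
    exact_mod_cast this
  calc |∑ m ∈ range (k * n + 2), eval u (C (sxTau k n (2 * n + 1 + m)) * (X - 1) ^ m)|
      ≤ ∑ m ∈ range (k * n + 2), |sxTau k n (2 * n + 1 + m)| := by
        refine (abs_sum_le_sum_abs _ _).trans (sum_le_sum fun m _ => ?_)
        simp only [eval_mul, eval_C, eval_pow, eval_sub, eval_X, eval_one, abs_mul, abs_pow]
        exact mul_le_of_le_one_right (abs_nonneg _) (pow_le_one₀ (abs_nonneg _) hu)
    _ ≤ ∑ m ∈ range (k * n + 2), ∑ j ∈ range (n + 1),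
          (c * ((k * j + 1).choose (2 * n + 1 + m) : ℝ) + c * ((k * j).choose (2 * n + 1 + m) : ℝ)) := by
        apply sum_le_sum
        intro m _
        unfold sxTau
        refine (abs_sum_le_sum_abs _ _).trans (sum_le_sum fun j hj => ?_)
        have hj' : j ≤ n := Nat.lt_succ_iff.mp (mem_range.mp hj)
        refine (abs_sub _ _).trans ?_
        rw [abs_of_nonneg (mul_nonneg (hb0 _) (by positivity)), abs_of_nonneg (mul_nonneg (hb0 _) (by positivity))]
        have h1 := sxB_cast_le k n j (by omega) hj'
        have h2 := sxB_cast_le k n (n - j) (by omega) (by omega)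
        gcongr
    _ = ∑ j ∈ range (n + 1), (c * ∑ m ∈ range (k * n + 2), ((k * j + 1).choose (2 * n + 1 + m) : ℝ)
          + c * ∑ m ∈ range (k * n + 2), ((k * j).choose (2 * n + 1 + m) : ℝ)) := by
        rw [sum_comm]
        apply sum_congr rfl
        intro j _
        rw [sum_add_distrib, mul_sum, mul_sum]
    _ ≤ ∑ j ∈ range (n + 1), (c * 2 ^ (k * n + 1) + c * 2 ^ (k * n + 1)) := by
        apply sum_le_sum
        intro j hj
        have hj' : j ≤ n := Nat.lt_succ_iff.mp (mem_range.mp hj)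
        have hkj : k * j ≤ k * n := Nat.mul_le_mul_left k hj'
        have := hch (k * j + 1) (by omega)
        have := hch (k * j) (by omega)
        gcongr
    _ = c * ((n + 1 : ℕ) * 2 * 2 ^ (k * n + 1)) := by
        rw [sum_const, card_range, nsmul_eq_mul]; ring
    _ ≤ sxK k ^ (n + 1) := by
        unfold sxK
        rw [mul_pow, ← hc]
        have h1 : ((n + 1 : ℕ) : ℝ) ≤ 2 ^ n := by exact_mod_cast Nat.lt_two_pow_self
        rw [mul_pow 2, ← pow_mul]
        have h2 : (2:ℝ) ^ (k * n + 1) ≤ 2 ^ ((k + 1) * (n + 1)) :=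
          pow_le_pow_right₀ (by norm_num) (by nlinarith)
        rw [pow_succ 2 n]
        gcongr

open Finset Polynomial in
lemma sx_pade_bound (k n : ℕ) (hk : 2 ≤ k) (u : ℝ) (hu : |u - 1| ≤ 1) :
    |u * (sxPB k n).eval (u ^ k) - (sxPA k n).eval (u ^ k)| ≤ sxK k ^ (n + 1) * |u - 1| ^ (2 * n + 1) := by
  have h := congrArg (eval u) (sx_pade_poly k n hk)
  simp only [eval_sub, eval_mul, eval_X, eval_comp, eval_pow, eval_one] at h
  rw [h, abs_mul, abs_pow, mul_comm]
  gcongr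
  exact sxR_bound k n hk u hu

open Polynomial in
lemma sx_dvd_of_comp (k m : ℕ) (hk : 1 ≤ k) (D : ℝ[X])
    (h : (X - 1) ^ m ∣ D.comp (X ^ k)) : (X - 1) ^ m ∣ D := by
  by_cases hD : D = 0
  · rw [hD]; exact dvd_zero _
  have e1 : (X - 1 : ℝ[X]) = X - C 1 := by simp
  obtain ⟨q, hq, hq1⟩ := exists_eq_pow_rootMultiplicity_mul_and_not_dvd D hD 1
  by_contra hcon
  set r := rootMultiplicity 1 D with hr
  have hrm : r < m := by
    by_contra hle
    apply hcon
    rw [e1, hq]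
    exact Dvd.dvd.mul_right (pow_dvd_pow _ (by omega)) _
  have hg : (X ^ k - 1 : ℝ[X]) = (X - 1) * (∑ i ∈ Finset.range k, X ^ i) := by
    rw [mul_comm, geom_sum_mul]
  have h2 : D.comp (X ^ k) = (X - 1) ^ r * ((∑ i ∈ Finset.range k, X ^ i) ^ r * q.comp (X ^ k)) := by
    conv_lhs => rw [hq]
    simp only [mul_comp, pow_comp, sub_comp, X_comp, C_comp]
    rw [C_1, hg, mul_pow]; ring
  have h3 : (X - 1 : ℝ[X]) ^ r * (X - 1) ∣ (X - 1) ^ r * ((∑ i ∈ Finset.range k, X ^ i) ^ r * q.comp (X ^ k)) := by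
    rw [← h2, ← pow_succ]
    exact (pow_dvd_pow _ (by omega)).trans h
  have hne : (X - 1 : ℝ[X]) ^ r ≠ 0 := by rw [e1]; exact pow_ne_zero _ (X_sub_C_ne_zero 1)
  have h4 := (mul_dvd_mul_iff_left hne).mp h3
  rw [e1, dvd_iff_isRoot, IsRoot.def] at h4
  simp only [eval_mul, eval_pow, eval_finsetSum, eval_X, one_pow, eval_comp, Finset.sum_const,
    Finset.card_range, nsmul_eq_mul, mul_one] at h4
  rcases mul_eq_zero.mp h4 with h5 | h5
  · have : (k : ℝ) ≠ 0 := by positivity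
    exact pow_ne_zero r this h5
  · exact hq1 (dvd_iff_isRoot.mpr h5)

open Polynomial in
lemma sxP_deg (k n : ℕ) : (sxPA k n).natDegree ≤ n ∧ (sxPB k n).natDegree ≤ n := by
  constructor <;>
  · apply natDegree_sum_le_of_forall_le
    intro i hi
    refine (natDegree_C_mul_X_pow_le _ _).trans ?_
    have := Finset.mem_range.mp hi
    omega

open Polynomial in
lemma sx_eval0 (k n : ℕ) : (sxPA k n).eval 0 = sxE k (-1) 0 n ∧ (sxPB k n).eval 0 = sxE k 1 0 n := by
  have hE : ∀ c j, sxE k c j 0 = 1 := by intro c j; simp [sxE]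
  constructor
  · unfold sxPA
    rw [eval_finsetSum, Finset.sum_eq_single 0]
    · simp [sxB, hE]
    · intro b _ hb; simp [hb]
    · simp
  · unfold sxPB
    rw [eval_finsetSum, Finset.sum_eq_single 0]
    · simp [sxB, hE]
    · intro b _ hb; simp [hb]
    · simp

lemma sxE_ne (k : ℕ) (hk : 2 ≤ k) (c : ℤ) (hc : -1 ≤ c) (n : ℕ) : (sxE k c 0 n : ℝ) ≠ 0 := by
  intro h
  have h1 := sxE_real k c 0 n
  rw [h] at h1
  have := sxP_ne k hk c (by exact_mod_cast hc) (0 + n)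
  have hk0 : (k : ℝ) ≠ 0 := by positivity
  have h3 : (k : ℝ) ^ n * sxP k c (0 + n) ≠ 0 := mul_ne_zero (pow_ne_zero _ hk0) this
  apply h3
  rw [← h1]; ring

lemma sxE_succ (k : ℕ) (c : ℤ) (n : ℕ) :
    ((n : ℝ) + 1) * (sxE k c 0 (n + 1) : ℝ) = k * (k * (n + 1) + c) * sxE k c 0 n := by
  have h1 := sxE_real k c 0 n
  have h2 := sxE_real k c 0 (n + 1)
  have e : sxP k c 0 = 1 := by simp [sxP]
  have e2 : sxP k c (n + 1) = sxP k c n * (k * (n + 1) + c) := by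
    simp [sxP, Finset.prod_range_succ]
  rw [e, zero_add] at h1 h2
  rw [e2, Nat.factorial_succ] at h2
  push_cast at h2
  have f : (n.factorial : ℝ) ≠ 0 := by positivity
  apply mul_left_cancel₀ f
  linear_combination h2 - k * (k * (n + 1) + c) * h1

open Polynomial in
lemma sx_nondeg (k n : ℕ) (hk : 2 ≤ k) (w : ℝ) (hw : w ≠ 1) :
    (sxPA k n).eval w * (sxPB k (n + 1)).eval w - (sxPA k (n + 1)).eval w * (sxPB k n).eval w ≠ 0 := by
  set D : ℝ[X] := sxPA k n * sxPB k (n + 1) - sxPA k (n + 1) * sxPB k n with hD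
  have hdvd : (X - 1) ^ (2 * n + 1) ∣ D := by
    apply sx_dvd_of_comp k _ (by omega)
    have h1 := sx_pade_poly k n hk
    have h2 := sx_pade_poly k (n + 1) hk
    refine ⟨(X - 1) ^ 2 * sxR k (n + 1) * (sxPB k n).comp (X ^ k) - sxR k n * (sxPB k (n + 1)).comp (X ^ k), ?_⟩
    rw [hD]
    simp only [sub_comp, mul_comp]
    linear_combination (sxPB k n).comp (X ^ k) * h2 - (sxPB k (n + 1)).comp (X ^ k) * h1
  have hD0 : D.eval 0 ≠ 0 := by
    rw [hD]
    simp only [eval_sub, eval_mul, (sx_eval0 k _).1, (sx_eval0 k _).2]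
    have s1 := sxE_succ k 1 n
    have s2 := sxE_succ k (-1) n
    have n1 := sxE_ne k hk 1 (by norm_num) n
    have n2 := sxE_ne k hk (-1) (by norm_num) n
    have hk0 : (k : ℝ) ≠ 0 := by positivity
    push_cast at s1 s2
    intro h
    have : 2 * (k : ℝ) * sxE k 1 0 n * sxE k (-1) 0 n = 0 := by
      linear_combination ((n : ℝ) + 1) * h - (sxE k (-1) 0 n : ℝ) * s1 + (sxE k 1 0 n : ℝ) * s2
    simp_all
  obtain ⟨q, hq⟩ := hdvd
  have e1 : (X - 1 : ℝ[X]) = X - C 1 := by simp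
  have hDne : D ≠ 0 := by rintro h; rw [h] at hD0; simp at hD0
  have hqne : q ≠ 0 := by rintro rfl; rw [mul_zero] at hq; exact hDne hq
  have hdeg : D.natDegree ≤ 2 * n + 1 := by
    rw [hD]
    refine (natDegree_sub_le _ _).trans (max_le ?_ ?_)
    · refine natDegree_mul_le.trans ?_
      have := (sxP_deg k n).1; have := (sxP_deg k (n + 1)).2; omega
    · refine natDegree_mul_le.trans ?_
      have := (sxP_deg k n).2; have := (sxP_deg k (n + 1)).1; omega
  have hq0 : q.natDegree = 0 := by
    rw [hq, e1, natDegree_mul (pow_ne_zero _ (X_sub_C_ne_zero 1)) hqne, natDegree_pow, natDegree_X_sub_C] at hdeg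
    omega
  rw [natDegree_eq_zero] at hq0
  obtain ⟨c, rfl⟩ := hq0
  have hc : c ≠ 0 := by rintro rfl; simp at hqne
  have : D.eval w = (w - 1) ^ (2 * n + 1) * c := by rw [hq]; simp
  have h5 : D.eval w ≠ 0 := by
    rw [this]; exact mul_ne_zero (pow_ne_zero _ (sub_ne_zero.mpr hw)) hc
  rw [hD] at h5
  simpa using h5

lemma sx_L_bound (k : ℕ) (hk : 1 ≤ k) (α β x y W : ℝ) (hα : 1 ≤ α) (hβ : 1 ≤ β) (hx : 0 ≤ x) (hy : 0 ≤ y)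
    (h : |α ^ k * y ^ k - β ^ k * x ^ k| ≤ W) :
    |α * y - β * x| * (x + y) ^ (k - 1) ≤ 2 ^ (k - 1) * W := by
  have hg := Commute.geom_sum₂_mul (Commute.all (α * y) (β * x)) k
  set G := ∑ i ∈ Finset.range k, (α * y) ^ i * (β * x) ^ (k - 1 - i) with hG
  have hay : 0 ≤ α * y := by positivity
  have hbx : 0 ≤ β * x := by positivity
  have hnn : ∀ i ∈ Finset.range k, 0 ≤ (α * y) ^ i * (β * x) ^ (k - 1 - i) := fun i _ => by positivity
  have hGx : x ^ (k - 1) ≤ G := by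
    have h1 := Finset.single_le_sum hnn (Finset.mem_range.mpr (by omega : 0 < k))
    refine le_trans ?_ h1
    simp only [pow_zero, one_mul, Nat.sub_zero]
    apply pow_le_pow_left₀ hx
    nlinarith
  have hGy : y ^ (k - 1) ≤ G := by
    have h1 := Finset.single_le_sum hnn (Finset.mem_range.mpr (by omega : k - 1 < k))
    refine le_trans ?_ h1
    simp only [Nat.sub_self, pow_zero, mul_one]
    apply pow_le_pow_left₀ hy
    nlinarith
  have hG0 : 0 ≤ G := Finset.sum_nonneg hnn
  have hs : (x + y) ^ (k - 1) ≤ 2 ^ (k - 1) * G := by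
    rcases le_total x y with hxy | hxy
    · calc (x + y) ^ (k - 1) ≤ (2 * y) ^ (k - 1) := pow_le_pow_left₀ (by positivity) (by linarith) _
        _ = 2 ^ (k - 1) * y ^ (k - 1) := mul_pow _ _ _
        _ ≤ _ := by gcongr
    · calc (x + y) ^ (k - 1) ≤ (2 * x) ^ (k - 1) := pow_le_pow_left₀ (by positivity) (by linarith) _
        _ = 2 ^ (k - 1) * x ^ (k - 1) := mul_pow _ _ _
        _ ≤ _ := by gcongr
  have h2 : |α * y - β * x| * G ≤ W := by
    rw [← mul_pow, ← mul_pow, ← hg, abs_mul, abs_of_nonneg hG0] at h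
    linarith
  calc _ ≤ |α * y - β * x| * (2 ^ (k - 1) * G) := by gcongr
    _ = 2 ^ (k - 1) * (|α * y - β * x| * G) := by ring
    _ ≤ _ := by gcongr

lemma sx_sep {ι : Type*} (S : Finset ι) (f : ι → ℝ) (lo r ε : ℝ) (hε : 0 < ε) (hr0 : 0 ≤ r)
    (hr : ∀ p ∈ S, lo ≤ f p ∧ f p ≤ lo + r)
    (hsep : ∀ p ∈ S, ∀ q ∈ S, p ≠ q → ε ≤ |f p - f q|) : (S.card : ℝ) ≤ r / ε + 1 := by
  have h : S.card ≤ (Finset.range (⌊r / ε⌋₊ + 1)).card := by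
    apply Finset.card_le_card_of_injOn (fun p => ⌊(f p - lo) / ε⌋₊)
    · intro p hp
      simp only [Finset.coe_range, Set.mem_Iio]
      apply Nat.lt_succ_of_le
      apply Nat.floor_le_floor
      have := (hr p hp).2
      gcongr
      linarith
    · intro p hp q hq hpq
      by_contra hne
      have h1 := hsep p hp q hq hne
      simp only at hpq
      have a1 := Nat.floor_le (div_nonneg (sub_nonneg.mpr (hr p hp).1) hε.le)
      have a2 := Nat.lt_floor_add_one ((f p - lo) / ε)
      have b1 := Nat.floor_le (div_nonneg (sub_nonneg.mpr (hr q hq).1) hε.le)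
      have b2 := Nat.lt_floor_add_one ((f q - lo) / ε)
      rw [hpq] at a1 a2
      have : |(f p - lo) / ε - (f q - lo) / ε| < 1 := by rw [abs_lt]; constructor <;> linarith
      rw [← sub_div, abs_div, abs_of_pos hε, div_lt_one hε] at this
      have e : f p - lo - (f q - lo) = f p - f q := by ring
      rw [e] at this
      linarith
  rw [Finset.card_range] at h
  have h2 := Nat.floor_le (div_nonneg hr0 hε.le)
  have h3 : (S.card : ℝ) ≤ (⌊r / ε⌋₊ : ℝ) + 1 := by exact_mod_cast h
  linarith

/-- coprime solution of the Thue inequality -/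
def sxSol (k a b : ℕ) (W : ℝ) (p : ℕ × ℕ) : Prop :=
  Nat.Coprime p.1 p.2 ∧ (a : ℝ) * (p.2 : ℝ) ^ k - b * (p.1 : ℝ) ^ k ≠ 0 ∧
    |(a : ℝ) * (p.2 : ℝ) ^ k - b * (p.1 : ℝ) ^ k| ≤ W

lemma sx_coprime_det {x₁ y₁ x₂ y₂ : ℕ} (h₁ : Nat.Coprime x₁ y₁) (h₂ : Nat.Coprime x₂ y₂)
    (h : x₁ * y₂ = x₂ * y₁) : (x₁, y₁) = (x₂, y₂) := by
  have a1 : x₁ ∣ x₂ := h₁.dvd_of_dvd_mul_right (h ▸ Dvd.intro _ rfl)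
  have a2 : x₂ ∣ x₁ := h₂.dvd_of_dvd_mul_right (h.symm ▸ Dvd.intro _ rfl)
  have b1 : y₁ ∣ y₂ := h₁.symm.dvd_of_dvd_mul_left (h.symm ▸ Dvd.intro_left _ rfl)
  have b2 : y₂ ∣ y₁ := h₂.symm.dvd_of_dvd_mul_left (h ▸ Dvd.intro_left _ rfl)
  rw [Nat.dvd_antisymm a1 a2, Nat.dvd_antisymm b1 b2]

lemma sx_det (α β : ℝ) (hα : 1 ≤ α) (hβ : 1 ≤ β) (p q : ℕ × ℕ) (hp : Nat.Coprime p.1 p.2)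
    (hq : Nat.Coprime q.1 q.2) (hpq : p ≠ q) :
    1 ≤ |(α * p.2 - β * p.1) * ((q.1 : ℝ) + q.2) - (α * q.2 - β * q.1) * ((p.1 : ℝ) + p.2)| := by
  have e : (α * p.2 - β * p.1) * ((q.1 : ℝ) + q.2) - (α * q.2 - β * q.1) * ((p.1 : ℝ) + p.2)
      = (α + β) * (((q.1 * p.2 : ℕ) : ℤ) - ((p.1 * q.2 : ℕ) : ℤ) : ℤ) := by push_cast; ring
  rw [e, abs_mul, abs_of_nonneg (by linarith)]
  have h1 : (((q.1 * p.2 : ℕ) : ℤ) - ((p.1 * q.2 : ℕ) : ℤ) : ℤ) ≠ 0 := by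
    intro h
    rw [sub_eq_zero] at h
    have h' : q.1 * p.2 = p.1 * q.2 := by exact_mod_cast h
    exact hpq (sx_coprime_det hp hq h'.symm)
  have h2 : (1 : ℝ) ≤ |((((q.1 * p.2 : ℕ) : ℤ) - ((p.1 * q.2 : ℕ) : ℤ) : ℤ) : ℝ)| := by
    exact_mod_cast Int.one_le_abs h1
  nlinarith

lemma sx_sol_L (k a b : ℕ) (hk : 3 ≤ k) (α β : ℝ) (hα : 1 ≤ α) (hβ : 1 ≤ β)
    (hαa : α ^ k = a) (hβb : β ^ k = b) {W : ℝ} {p : ℕ × ℕ} (h : sxSol k a b W p) :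
    |α * p.2 - β * p.1| * ((p.1 : ℝ) + p.2) ^ (k - 1) ≤ 2 ^ (k - 1) * W :=
  sx_L_bound k (by omega) α β p.1 p.2 W hα hβ (by positivity) (by positivity) (by
    rw [hαa, hβb]; exact h.2.2)

lemma sx_block (k a b : ℕ) (hk : 3 ≤ k) (α β : ℝ) (hα : 1 ≤ α) (hβ : 1 ≤ β)
    (hαa : α ^ k = a) (hβb : β ^ k = b) (W T : ℝ) (hW : 0 ≤ W) (hT : 0 < T) (S : Finset (ℕ × ℕ)) (hS : ∀ p ∈ S, sxSol k a b W p)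
    (hS1 : ∀ p ∈ S, T < (p.1 : ℝ) + p.2) (hS2 : ∀ p ∈ S, (p.1 : ℝ) + p.2 ≤ 2 * T) :
    (S.card : ℝ) ≤ 8 * 2 ^ (k - 1) * W / T ^ (k - 2) + 1 := by
  obtain ⟨j, rfl⟩ : ∃ j, k = j + 2 := ⟨k - 2, by omega⟩
  have e1 : j + 2 - 1 = j + 1 := rfl
  have e2 : j + 2 - 2 = j := rfl
  have := sx_sep S (fun p => (α * p.2 - β * p.1) / ((p.1 : ℝ) + p.2)) (-(2 ^ (j + 1) * W / T ^ (j + 2)))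
    (2 * (2 ^ (j + 1) * W / T ^ (j + 2))) (1 / (4 * T ^ 2)) (by positivity) (by positivity) ?_ ?_
  · refine this.trans (le_of_eq ?_)
    rw [e1, e2]
    field_simp
    ring
  · intro p hp
    have h1 := sx_sol_L (j + 2) a b hk α β hα hβ hαa hβb (hS p hp)
    rw [e1] at h1
    have hs := hS1 p hp
    set s := (p.1 : ℝ) + p.2
    have hs0 : 0 < s := hT.trans hs
    have h2 : |(α * p.2 - β * p.1) / s| ≤ 2 ^ (j + 1) * W / T ^ (j + 2) := by
      rw [abs_div, abs_of_pos hs0]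
      calc |α * p.2 - β * p.1| / s = (|α * p.2 - β * p.1| * s ^ (j + 1)) / s ^ (j + 2) := by
            rw [div_eq_div_iff hs0.ne' (by positivity)]; ring
        _ ≤ (2 ^ (j + 1) * W) / T ^ (j + 2) := by gcongr
    rw [abs_le] at h2
    constructor
    · exact h2.1
    · linarith [h2.2]
  · intro p hp q hq hpq
    have h1 := sx_det α β hα hβ p q (hS p hp).1 (hS q hq).1 hpq
    have a1 := hS1 p hp
    have a2 := hS1 q hq
    have a3 := hS2 p hp
    have a4 := hS2 q hq
    set s := (p.1 : ℝ) + p.2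
    set t := (q.1 : ℝ) + q.2
    have hs0 : 0 < s := hT.trans a1
    have ht0 : 0 < t := hT.trans a2
    rw [div_sub_div _ _ hs0.ne' ht0.ne', abs_div, abs_of_pos (mul_pos hs0 ht0), mul_comm s (α * q.2 - β * q.1)]
    apply div_le_div₀ (by positivity) h1 (by positivity)
    calc s * t ≤ (2 * T) * (2 * T) := by gcongr
      _ = _ := by ring

lemma sx_medium (k a b : ℕ) (hk : 3 ≤ k) (α β : ℝ) (hα : 1 ≤ α) (hβ : 1 ≤ β)
    (hαa : α ^ k = a) (hβb : β ^ k = b) (W M : ℝ) (hW : 0 ≤ W) (hM : 0 < M) (m : ℕ) : ∀ (S : Finset (ℕ × ℕ)),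
    (∀ p ∈ S, sxSol k a b W p) → 
    (∀ p ∈ S, M < (p.1 : ℝ) + p.2) → (∀ p ∈ S, (p.1 : ℝ) + p.2 ≤ 2 ^ m * M) →
    (S.card : ℝ) ≤ m + 16 * 2 ^ (k - 1) * W / M ^ (k - 2) * (1 - (1 / 2) ^ m) := by
  induction m with
  | zero =>
    intro S _ h1 h2
    have : S = ∅ := by
      apply Finset.eq_empty_of_forall_notMem
      intro p hp
      have := h1 p hp; have := h2 p hp; simp at *; linarith
    rw [this]; simp
  | succ m ih =>
    intro S hS h1 h2
    classical
    rw [← Finset.card_filter_add_card_filter_not (s := S) (fun p => (p.1 : ℝ) + p.2 ≤ 2 ^ m * M)]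
    have i1 := ih (S.filter (fun p => (p.1 : ℝ) + p.2 ≤ 2 ^ m * M))
      (fun p hp => hS p (Finset.mem_filter.mp hp).1) (fun p hp => h1 p (Finset.mem_filter.mp hp).1)
      (fun p hp => (Finset.mem_filter.mp hp).2)
    have i2 := sx_block k a b hk α β hα hβ hαa hβb W (2 ^ m * M) hW (by positivity)
      (S.filter (fun p => ¬ (p.1 : ℝ) + p.2 ≤ 2 ^ m * M))
      (fun p hp => hS p (Finset.mem_filter.mp hp).1) (fun p hp => not_le.mp (Finset.mem_filter.mp hp).2)
      (fun p hp => by have := h2 p (Finset.mem_filter.mp hp).1; rw [pow_succ] at this; linarith)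
    have i3 : 8 * 2 ^ (k - 1) * W / (2 ^ m * M) ^ (k - 2) ≤ 8 * 2 ^ (k - 1) * W / M ^ (k - 2) * (1 / 2) ^ m := by
      rw [mul_pow]
      have : (2:ℝ) ^ m ≤ (2 ^ m) ^ (k - 2) := le_self_pow₀ (one_le_pow₀ (by norm_num)) (by omega)
      calc 8 * 2 ^ (k - 1) * W / ((2 ^ m) ^ (k - 2) * M ^ (k - 2)) ≤ 8 * 2 ^ (k - 1) * W / (2 ^ m * M ^ (k - 2)) := by
            gcongr
        _ = _ := by rw [one_div, inv_pow]; field_simp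
    push_cast
    rw [pow_succ (1 / 2 : ℝ)]
    have : 16 * 2 ^ (k - 1) * W / M ^ (k - 2) = 2 * (8 * 2 ^ (k - 1) * W / M ^ (k - 2)) := by ring
    rw [this] at i1 ⊢
    nlinarith


/-- integer Pade numerator -/
def sxIA (k a b n x y : ℕ) : ℤ :=
  ∑ j ∈ Finset.range (n + 1), sxB k n (n - j) * ((a * y ^ k : ℕ) : ℤ) ^ j * ((b * x ^ k : ℕ) : ℤ) ^ (n - j)

/-- integer Pade denominator -/
def sxIB (k a b n x y : ℕ) : ℤ :=
  ∑ j ∈ Finset.range (n + 1), sxB k n j * ((a * y ^ k : ℕ) : ℤ) ^ j * ((b * x ^ k : ℕ) : ℤ) ^ (n - j)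

open Polynomial in
lemma sx_IA_eval (k a b n x y : ℕ) (hb : 0 < b) (hx : 0 < x) :
    (sxIA k a b n x y : ℝ) = ((b : ℝ) * x ^ k) ^ n * (sxPA k n).eval (((a : ℝ) * y ^ k) / (b * x ^ k)) := by
  unfold sxIA sxPA
  rw [eval_finsetSum, Finset.mul_sum]
  push_cast
  apply Finset.sum_congr rfl
  intro j hj
  have hj' : j ≤ n := Nat.lt_succ_iff.mp (Finset.mem_range.mp hj)
  obtain ⟨r, rfl⟩ := Nat.exists_eq_add_of_le hj'
  have h0 : ((b : ℝ) * x ^ k) ≠ 0 := by positivity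
  simp only [eval_mul, eval_C, eval_pow, eval_X]
  rw [Nat.add_sub_cancel_left, pow_add ((b : ℝ) * x ^ k), div_pow]
  field_simp

open Polynomial in
lemma sx_IB_eval (k a b n x y : ℕ) (hb : 0 < b) (hx : 0 < x) :
    (sxIB k a b n x y : ℝ) = ((b : ℝ) * x ^ k) ^ n * (sxPB k n).eval (((a : ℝ) * y ^ k) / (b * x ^ k)) := by
  unfold sxIB sxPB
  rw [eval_finsetSum, Finset.mul_sum]
  push_cast
  apply Finset.sum_congr rfl
  intro j hj
  have hj' : j ≤ n := Nat.lt_succ_iff.mp (Finset.mem_range.mp hj)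
  obtain ⟨r, rfl⟩ := Nat.exists_eq_add_of_le hj'
  have h0 : ((b : ℝ) * x ^ k) ≠ 0 := by positivity
  simp only [eval_mul, eval_C, eval_pow, eval_X]
  rw [Nat.add_sub_cancel_left, pow_add ((b : ℝ) * x ^ k), div_pow]
  field_simp

lemma sxK_one (k : ℕ) (hk : 1 ≤ k) : 1 ≤ sxK k := by
  unfold sxK
  have h1 : (1:ℝ) ≤ k := by exact_mod_cast hk
  have : (1:ℝ) ≤ 2 ^ (k + 1) := one_le_pow₀ (by norm_num)
  have h2 : (1:ℝ) ≤ 4 * (k:ℝ) ^ 2 := by nlinarith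
  exact one_le_mul_of_one_le_of_one_le h2 (by linarith)

lemma sx_IA_bound (k a b n x y : ℕ) (hk : 1 ≤ k) (hb : 0 < b) :
    |(sxIA k a b n x y : ℝ)| ≤ (2 * sxK k * (a + b)) ^ (n + 1) * ((x : ℝ) + y) ^ (k * n) := by
  have hK := sxK_one k hk
  unfold sxIA
  push_cast
  have hb1 : (1:ℝ) ≤ b := by exact_mod_cast hb
  set s := (x : ℝ) + y with hs
  have hsx : (x : ℝ) ≤ s := by simp [hs]
  have hsy : (y : ℝ) ≤ s := by simp [hs]
  have hs0 : 0 ≤ s := by positivity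
  calc _ ≤ ∑ j ∈ Finset.range (n + 1), sxK k ^ (n + 1) * (((a : ℝ) + b) * s ^ k) ^ n := by
        refine (Finset.abs_sum_le_sum_abs _ _).trans (Finset.sum_le_sum fun j hj => ?_)
        have hj' : j ≤ n := Nat.lt_succ_iff.mp (Finset.mem_range.mp hj)
        have h0 : (0:ℝ) ≤ sxB k n (n - j) := by exact_mod_cast sxB_nonneg k n (n - j) hk
        rw [abs_of_nonneg (by positivity), mul_assoc]
        have e1 : ((a : ℝ) * y ^ k) ≤ (a + b) * s ^ k := by
          gcongr
          linarith
        have e2 : ((b : ℝ) * x ^ k) ≤ (a + b) * s ^ k := by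
          gcongr
          linarith [(Nat.cast_nonneg a : (0:ℝ) ≤ a)]
        calc (sxB k n (n - j) : ℝ) * (((a : ℝ) * y ^ k) ^ j * ((b : ℝ) * x ^ k) ^ (n - j))
            ≤ sxK k ^ (n + 1) * (((a + b) * s ^ k) ^ j * ((a + b) * s ^ k) ^ (n - j)) := by
              have := sxB_le_K k n (n - j) hk (by omega)
              gcongr
          _ = _ := by rw [← pow_add, Nat.add_sub_cancel' hj']
    _ = (n + 1 : ℕ) * (sxK k ^ (n + 1) * ((a + b) ^ n * s ^ (k * n))) := by
        rw [Finset.sum_const, Finset.card_range, nsmul_eq_mul, mul_pow ((a : ℝ) + b), ← pow_mul]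
    _ ≤ 2 ^ (n + 1) * (sxK k ^ (n + 1) * ((a + b) ^ (n + 1) * s ^ (k * n))) := by
        have h1 : ((n + 1 : ℕ) : ℝ) ≤ 2 ^ (n + 1) := by exact_mod_cast Nat.lt_two_pow_self.le
        have h2 : ((a : ℝ) + b) ^ n ≤ (a + b) ^ (n + 1) :=
          pow_le_pow_right₀ (by linarith [(Nat.cast_nonneg a : (0:ℝ) ≤ a)]) (Nat.le_succ n)
        gcongr
    _ = _ := by rw [mul_pow, mul_pow]; ring

/-- the main constant -/
noncomputable def sxG (k a b : ℕ) : ℝ := 2 * sxK k * (a + b) * 2 ^ (k - 1)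

set_option maxHeartbeats 2000000 in
lemma sx_pade_det (k a b : ℕ) (hk : 3 ≤ k) (α β : ℝ) (hα : 1 ≤ α) (hβ : 1 ≤ β)
    (hαa : α ^ k = a) (hβb : β ^ k = b) (W : ℝ) (hW : 1 ≤ W) (p₀ p : ℕ × ℕ) (h₀ : sxSol k a b W p₀)
    (h : sxSol k a b W p) (hs : sxG k a b * W < (p₀.1 : ℝ) + p₀.2) (hs1 : 0 < p.1 + p.2) (m : ℕ)
    (hdet : (p₀.1 : ℤ) * sxIA k a b m p₀.1 p₀.2 * p.2 - p₀.2 * sxIB k a b m p₀.1 p₀.2 * p.1 ≠ 0) :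
    1 ≤ (sxG k a b * W) ^ (2 * m + 2) * (((p₀.1 : ℝ) + p₀.2) ^ (k * m + 1) / ((p.1 : ℝ) + p.2) ^ (k - 1)
      + ((p.1 : ℝ) + p.2) / ((p₀.1 : ℝ) + p₀.2) ^ (k * m + k - 1)) := by
  obtain ⟨x₀, y₀⟩ := p₀
  obtain ⟨x, y⟩ := p
  simp only at *
  have L0 := sx_sol_L k a b hk α β hα hβ hαa hβb h₀
  have L1 := sx_sol_L k a b hk α β hα hβ hαa hβb h
  simp only at L0 L1
  have hK := sxK_one k (by omega)
  have hb : 0 < b := by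
    rcases Nat.eq_zero_or_pos b with h | h
    · have : (1:ℝ) ≤ β ^ k := one_le_pow₀ hβ
      rw [hβb, h] at this; norm_num at this
    · exact h
  have hb1 : (1:ℝ) ≤ b := by exact_mod_cast hb
  have ha0 : (0:ℝ) ≤ a := Nat.cast_nonneg a
  set c : ℝ := 2 ^ (k - 1) with hc
  have hc1 : 1 ≤ c := one_le_pow₀ (by norm_num)
  set K := sxK k with hKd
  set G1 : ℝ := 2 * K * (a + b) with hG1
  have hG1b : K * b ≤ G1 := by rw [hG1]; nlinarith
  have hKb1 : 1 ≤ K * b := one_le_mul_of_one_le_of_one_le hK hb1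
  have hG11 : 1 ≤ G1 := hKb1.trans hG1b
  have hcW : 1 ≤ c * W := one_le_mul_of_one_le_of_one_le hc1 hW
  have hG : sxG k a b * W = G1 * (c * W) := by rw [sxG, hG1]; ring
  rw [hG] at hs ⊢
  have hGc : c * W ≤ G1 * (c * W) := le_mul_of_one_le_left (by linarith) hG11
  set s₀ := (x₀ : ℝ) + y₀ with hs₀
  set s := (x : ℝ) + y with hsd
  have hs0pos : 0 < s₀ := by linarith
  have hs01 : 1 ≤ s₀ := by linarith
  have hspos : 0 < s := by rw [hsd]; exact_mod_cast hs1
  set l₀ := α * y₀ - β * x₀ with hl₀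
  set l := α * y - β * x with hl
  have hl0 : |l₀| < 1 := by
    by_contra hcon
    push Not at hcon
    have h1 : s₀ ≤ s₀ ^ (k - 1) := le_self_pow₀ hs01 (by omega)
    have h2 : s₀ ^ (k - 1) ≤ |l₀| * s₀ ^ (k - 1) := le_mul_of_one_le_left (by positivity) hcon
    linarith
  have hx0 : 0 < x₀ := by
    rcases Nat.eq_zero_or_pos x₀ with h | h
    · exfalso
      have e : s₀ = y₀ := by rw [hs₀, h]; simp
      have : l₀ = α * s₀ := by rw [hl₀, h, e]; simp
      rw [this, abs_of_nonneg (by positivity)] at hl0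
      nlinarith
    · exact h
  have hx01 : (1:ℝ) ≤ x₀ := by exact_mod_cast hx0
  have hbx : 1 ≤ β * x₀ := one_le_mul_of_one_le_of_one_le hβ hx01
  have hbx0 : 0 < β * x₀ := by linarith
  set u := α * y₀ / (β * x₀) with hu
  have hu1 : u - 1 = l₀ / (β * x₀) := by rw [hu, hl₀]; field_simp
  have hu2 : |u - 1| ≤ 1 := by
    rw [hu1, abs_div, abs_of_pos hbx0, div_le_one hbx0]; linarith
  have huk : u ^ k = ((a : ℝ) * y₀ ^ k) / (b * x₀ ^ k) := by
    rw [hu, div_pow, mul_pow, mul_pow, hαa, hβb]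
  have hbxk : (b : ℝ) * x₀ ^ k = (β * x₀) ^ k := by rw [mul_pow, hβb]
  have PB := sx_pade_bound k m (by omega) u hu2
  have eA := sx_IA_eval k a b m x₀ y₀ hb hx0
  have eB := sx_IB_eval k a b m x₀ y₀ hb hx0
  rw [← huk, hbxk] at eA eB
  set P : ℤ := sxIA k a b m x₀ y₀
  set Q : ℤ := sxIB k a b m x₀ y₀
  -- the new approximation
  have el : α * (y₀ * Q) - β * (x₀ * P) = (β * x₀) ^ (k * m + 1) *
      (u * (sxPB k m).eval (u ^ k) - (sxPA k m).eval (u ^ k)) := by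
    have : α * y₀ = u * (β * x₀) := by rw [hu]; field_simp
    rw [eA, eB]
    calc _ = (α * y₀) * (((β * x₀) ^ k) ^ m * (sxPB k m).eval (u ^ k)) - (β * x₀) * (((β * x₀) ^ k) ^ m * (sxPA k m).eval (u ^ k)) := by ring
      _ = _ := by rw [this, ← pow_mul]; ring
  obtain ⟨j, rfl⟩ : ∃ j, k = j + 2 := ⟨k - 2, by omega⟩
  have ek1 : j + 2 - 1 = j + 1 := rfl
  have lt : |α * (y₀ * Q) - β * (x₀ * P)| ≤ (G1 * (c * W)) ^ (2 * m + 2) / s₀ ^ ((j + 2) * m + (j + 2) - 1) := by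
    rw [el, abs_mul, abs_of_pos (pow_pos hbx0 _)]
    have hL0' : |l₀| ≤ c * W / s₀ ^ (j + 1) := by
      rw [le_div_iff₀ (by positivity)]; exact L0
    have hbs : β * x₀ ≤ β * s₀ := by
      gcongr
      rw [hs₀]; simp
    calc (β * x₀) ^ ((j + 2) * m + 1) * |u * (sxPB (j+2) m).eval (u ^ (j+2)) - (sxPA (j+2) m).eval (u ^ (j+2))|
        ≤ (β * x₀) ^ ((j + 2) * m + 1) * (K ^ (m + 1) * |u - 1| ^ (2 * m + 1)) := by gcongr
      _ = K ^ (m + 1) * ((β * x₀) ^ (j * m) * |l₀| ^ (2 * m + 1)) := by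
          rw [hu1, abs_div, abs_of_pos hbx0, div_pow]
          have : (β * x₀) ^ ((j + 2) * m + 1) = (β * x₀) ^ (j * m) * (β * x₀) ^ (2 * m + 1) := by
            rw [← pow_add]; ring_nf
          rw [this]
          field_simp
      _ ≤ K ^ (m + 1) * ((β * s₀) ^ (j * m) * (c * W / s₀ ^ (j + 1)) ^ (2 * m + 1)) := by gcongr
      _ = K ^ (m + 1) * (β ^ (j * m)) * (c * W) ^ (2 * m + 1) / s₀ ^ ((j + 2) * m + (j + 2) - 1) := by
          rw [mul_pow, div_pow, ← pow_mul]
          have : s₀ ^ ((j + 1) * (2 * m + 1)) = s₀ ^ (j * m) * s₀ ^ ((j + 2) * m + (j + 2) - 1) := by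
            rw [← pow_add]; congr 1
            have : (j + 2) * m + (j + 2) - 1 = (j + 2) * m + (j + 1) := by omega
            rw [this]; ring
          rw [this]
          field_simp
      _ ≤ K ^ (m + 1) * (b ^ (m + 1)) * (c * W) ^ (2 * m + 1) / s₀ ^ ((j + 2) * m + (j + 2) - 1) := by
          have : β ^ (j * m) ≤ (b : ℝ) ^ (m + 1) := by
            rw [← hβb, ← pow_mul]
            exact pow_le_pow_right₀ hβ (by nlinarith)
          gcongr
      _ ≤ _ := by
          gcongr
          rw [← mul_pow, mul_pow G1]
          have h1 : (K * b) ^ (m + 1) ≤ G1 ^ (2 * m + 2) :=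
            (pow_le_pow_left₀ (by linarith) hG1b _).trans (pow_le_pow_right₀ hG11 (by omega))
          have h2 : (c * W) ^ (2 * m + 1) ≤ (c * W) ^ (2 * m + 2) := pow_le_pow_right₀ hcW (by omega)
          gcongr
  have hP := sx_IA_bound (j + 2) a b m x₀ y₀ (by omega) hb
  have t1 : |(x₀ : ℝ) * P| * |l| ≤ (G1 * (c * W)) ^ (2 * m + 2) * (s₀ ^ ((j + 2) * m + 1) / s ^ (j + 1)) := by
    have hl1 : |l| ≤ c * W / s ^ (j + 1) := by
      rw [le_div_iff₀ (by positivity)]; exact L1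
    rw [abs_mul, abs_of_nonneg (by positivity : (0:ℝ) ≤ x₀)]
    have hxs : (x₀ : ℝ) ≤ s₀ := by rw [hs₀]; simp
    calc (x₀ : ℝ) * |(P : ℝ)| * |l| ≤ s₀ * (G1 ^ (m + 1) * s₀ ^ ((j + 2) * m)) * (c * W / s ^ (j + 1)) := by gcongr
      _ = (G1 ^ (m + 1) * (c * W)) * (s₀ ^ ((j + 2) * m + 1) / s ^ (j + 1)) := by ring
      _ ≤ _ := by
        rw [mul_pow G1 (c * W)]
        have h1 : G1 ^ (m + 1) ≤ G1 ^ (2 * m + 2) := pow_le_pow_right₀ hG11 (by omega)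
        have h2 : (c * W) ≤ (c * W) ^ (2 * m + 2) := le_self_pow₀ hcW (by omega)
        gcongr
  have hxs : (x : ℝ) ≤ s := by rw [hsd]; simp
  have hd1 : (1:ℝ) ≤ |(x₀ : ℝ) * P * y - y₀ * Q * x| := by
    have := Int.one_le_abs hdet
    exact_mod_cast this
  have hd2 : α * ((x₀ : ℝ) * P * y - y₀ * Q * x) = (x₀ * P) * l - x * (α * (y₀ * Q) - β * (x₀ * P)) := by
    rw [hl]; ring
  have hd3 : 1 ≤ |(x₀ * P) * l - x * (α * (y₀ * Q) - β * (x₀ * P))| := by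
    rw [← hd2, abs_mul, abs_of_nonneg (by linarith)]
    exact one_le_mul_of_one_le_of_one_le hα hd1
  refine hd3.trans ((abs_sub _ _).trans ?_)
  rw [mul_add, abs_mul, abs_mul (x : ℝ)]
  apply add_le_add t1
  rw [abs_of_nonneg (by positivity : (0:ℝ) ≤ x)]
  calc (x : ℝ) * |α * (y₀ * Q) - β * (x₀ * P)| ≤ s * ((G1 * (c * W)) ^ (2 * m + 2) / s₀ ^ ((j + 2) * m + (j + 2) - 1)) := by
        gcongr
    _ = _ := by ring

lemma sx_b_pos (k b : ℕ) (β : ℝ) (hβ : 1 ≤ β) (hβb : β ^ k = b) : (1:ℝ) ≤ b := by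
  rw [← hβb]; exact one_le_pow₀ hβ

lemma sxG_ge (k a b : ℕ) (hk : 1 ≤ k) (ha : (1:ℝ) ≤ a) (hb : (1:ℝ) ≤ b) :
    2 * 2 ^ (k - 1) ≤ sxG k a b ∧ 2 ≤ sxG k a b := by
  have hK := sxK_one k hk
  have hc1 : (1:ℝ) ≤ 2 ^ (k - 1) := one_le_pow₀ (by norm_num)
  have h : 2 * (2:ℝ) ^ (k - 1) ≤ sxG k a b := by
    unfold sxG
    have h1 : 2 ≤ 2 * sxK k * (a + b) := by nlinarith
    gcongr
  exact ⟨h, by linarith⟩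

/-- Real arithmetic at the end of the exclusion argument. -/
lemma sx_arith (k n m : ℕ) (hk : 3 ≤ k) (hn : 7 ≤ n) (hm : n ≤ m) (hm1 : m ≤ n + 1) (G s₀ s : ℝ)
    (hG : 2 ≤ G) (hs₀ : G ^ 4 < s₀) (hs : 0 < s)
    (h1 : s ^ 2 < s₀ ^ ((2 * k - 1) * (n + 1) - 4)) (h2 : s₀ ^ ((2 * k - 1) * n - 4) ≤ s ^ 2) :
    G ^ (2 * m + 2) * (s₀ ^ (k * m + 1) / s ^ (k - 1) + s / s₀ ^ (k * m + k - 1)) < 1 := by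
  have hG16 : (16:ℝ) ≤ G ^ 4 := by
    calc (16:ℝ) = 2 ^ 4 := by norm_num
      _ ≤ _ := pow_le_pow_left₀ (by norm_num) hG 4
  have hs2 : 2 ≤ s₀ := by linarith
  have hs1 : 1 ≤ s₀ := by linarith
  have hs0 : 0 < s₀ := by linarith
  have hG0 : 0 < G := by linarith
  have h4 : (4:ℝ) ≤ s₀ ^ 2 := by nlinarith
  have hGp : (G ^ (2 * m + 2)) ^ 2 ≤ s₀ ^ (m + 1) := by
    calc (G ^ (2 * m + 2)) ^ 2 = (G ^ 4) ^ (m + 1) := by rw [← pow_mul, ← pow_mul]; ring_nf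
      _ ≤ _ := pow_le_pow_left₀ (by positivity) hs₀.le _
  obtain ⟨t, rfl⟩ := Nat.exists_eq_add_of_le hk
  obtain ⟨r, rfl⟩ := Nat.exists_eq_add_of_le hn
  have ex1 : (2 * (3 + t) - 1) * (7 + r + 1) - 4 = (5 + 2 * t) * (8 + r) - 4 := by
    rw [show 2 * (3 + t) - 1 = 5 + 2 * t by omega]; ring_nf
  have ex2 : (2 * (3 + t) - 1) * (7 + r) - 4 = 31 + 5 * r + 14 * t + 2 * t * r := by
    rw [show 2 * (3 + t) - 1 = 5 + 2 * t by omega]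
    have : (5 + 2 * t) * (7 + r) = 31 + 5 * r + 14 * t + 2 * t * r + 4 := by ring
    omega
  rw [ex1] at h1
  rw [ex2] at h2
  -- first term
  have T1 : G ^ (2 * m + 2) * (s₀ ^ ((3 + t) * m + 1) / s ^ (3 + t - 1)) ≤ 1 / 2 := by
    have q : (2 * (G ^ (2 * m + 2) * s₀ ^ ((3 + t) * m + 1))) ^ 2 ≤ (s ^ (2 + t)) ^ 2 := by
      calc (2 * (G ^ (2 * m + 2) * s₀ ^ ((3 + t) * m + 1))) ^ 2
          = 4 * ((G ^ (2 * m + 2)) ^ 2 * (s₀ ^ ((3 + t) * m + 1)) ^ 2) := by ring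
        _ ≤ s₀ ^ 2 * (s₀ ^ (m + 1) * (s₀ ^ ((3 + t) * m + 1)) ^ 2) := by gcongr
        _ = s₀ ^ (2 + ((m + 1) + ((3 + t) * m + 1) * 2)) := by rw [← pow_mul, ← pow_add, ← pow_add]
        _ ≤ s₀ ^ ((31 + 5 * r + 14 * t + 2 * t * r) * (2 + t)) := by
            apply pow_le_pow_right₀ hs1
            have e : 2 + ((m + 1) + ((3 + t) * m + 1) * 2) = (7 + 2 * t) * m + 5 := by ring
            rw [e]
            calc (7 + 2 * t) * m + 5 ≤ (7 + 2 * t) * (7 + r + 1) + 5 := by gcongr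
              _ ≤ _ := by nlinarith [Nat.zero_le (t * r), Nat.zero_le (t * t), Nat.zero_le (t * t * r)]
        _ = (s₀ ^ (31 + 5 * r + 14 * t + 2 * t * r)) ^ (2 + t) := by rw [pow_mul]
        _ ≤ (s ^ 2) ^ (2 + t) := by gcongr
        _ = _ := by rw [← pow_mul, ← pow_mul, mul_comm]
    have q2 := (pow_le_pow_iff_left₀ (by positivity) (by positivity) (by norm_num)).mp q
    rw [show 3 + t - 1 = 2 + t by omega, ← mul_div_assoc, div_le_iff₀ (by positivity)]
    linarith
  have T2 : G ^ (2 * m + 2) * (s / s₀ ^ ((3 + t) * m + (3 + t) - 1)) < 1 / 2 := by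
    have e : (3 + t) * m + (3 + t) - 1 = (3 + t) * m + (2 + t) := by omega
    rw [e]
    have q : (2 * (G ^ (2 * m + 2) * s)) ^ 2 < (s₀ ^ ((3 + t) * m + (2 + t))) ^ 2 := by
      calc (2 * (G ^ (2 * m + 2) * s)) ^ 2
          = 4 * ((G ^ (2 * m + 2)) ^ 2 * s ^ 2) := by ring
        _ < s₀ ^ 2 * (s₀ ^ (m + 1) * s₀ ^ ((5 + 2 * t) * (8 + r) - 4)) := by
            have : (G ^ (2 * m + 2)) ^ 2 * s ^ 2 < s₀ ^ (m + 1) * s₀ ^ ((5 + 2 * t) * (8 + r) - 4) :=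
              mul_lt_mul' hGp h1 (by positivity) (by positivity)
            have h5 : 0 < (G ^ (2 * m + 2)) ^ 2 * s ^ 2 := by positivity
            nlinarith
        _ = s₀ ^ (2 + ((m + 1) + ((5 + 2 * t) * (8 + r) - 4))) := by rw [← pow_add, ← pow_add]
        _ ≤ s₀ ^ (((3 + t) * m + (2 + t)) * 2) := by
            apply pow_le_pow_right₀ hs1
            have h6 : (5 + 2 * t) * (8 + r) ≤ (5 + 2 * t) * (m + 1) := Nat.mul_le_mul_left _ (by omega)
            have h7 : ((3 + t) * m + (2 + t)) * 2 + 2 = (m + 1) + (5 + 2 * t) * (m + 1) := by ring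
            have h8 : 40 ≤ (5 + 2 * t) * (8 + r) := by nlinarith [Nat.zero_le (t * r)]
            omega
        _ = _ := by rw [pow_mul]
    have q2 := (pow_lt_pow_iff_left₀ (by positivity) (by positivity) (by norm_num)).mp q
    rw [← mul_div_assoc, div_lt_iff₀ (by positivity)]
    linarith
  rw [mul_add]
  linarith

lemma sx_exclusion (k a b : ℕ) (hk : 3 ≤ k) (α β : ℝ) (hα : 1 ≤ α) (hβ : 1 ≤ β)
    (hαa : α ^ k = a) (hβb : β ^ k = b) (W : ℝ) (hW : 1 ≤ W) (p₀ p : ℕ × ℕ) (h₀ : sxSol k a b W p₀)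
    (h : sxSol k a b W p) (hs : (sxG k a b * W) ^ 4 < (p₀.1 : ℝ) + p₀.2) (hs1 : 0 < p.1 + p.2) :
    (p.1 : ℝ) + p.2 < ((p₀.1 : ℝ) + p₀.2) ^ (7 * k) := by
  by_contra hcon
  push Not at hcon
  have ha := sx_b_pos k a α hα hαa
  have hb := sx_b_pos k b β hβ hβb
  have hG2 : 2 ≤ sxG k a b * W := by
    have := (sxG_ge k a b (by omega) ha hb).2
    nlinarith
  set G := sxG k a b * W with hG
  have hsG : G < (p₀.1 : ℝ) + p₀.2 := lt_of_le_of_lt (le_self_pow₀ (by linarith) (by norm_num)) hs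
  have hspos : (0:ℝ) < (p.1 : ℝ) + p.2 := by exact_mod_cast hs1
  have key : ∀ m, (p₀.1 : ℤ) * sxIA k a b m p₀.1 p₀.2 * p.2 - p₀.2 * sxIB k a b m p₀.1 p₀.2 * p.1 ≠ 0 →
      1 ≤ G ^ (2 * m + 2) * (((p₀.1 : ℝ) + p₀.2) ^ (k * m + 1) / ((p.1 : ℝ) + p.2) ^ (k - 1)
      + ((p.1 : ℝ) + p.2) / ((p₀.1 : ℝ) + p₀.2) ^ (k * m + k - 1)) := fun m hm =>
    sx_pade_det k a b hk α β hα hβ hαa hβb W hW p₀ p h₀ h hsG hs1 m hm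
  -- choice of n
  set s₀ := (p₀.1 : ℝ) + p₀.2 with hs₀
  set s := (p.1 : ℝ) + p.2 with hsd
  have hs01 : 1 < s₀ := by linarith
  have hex : ∃ n : ℕ, s ^ 2 < s₀ ^ ((2 * k - 1) * (n + 1) - 4) := by
    obtain ⟨N, hN⟩ := pow_unbounded_of_one_lt (s ^ 2) hs01
    refine ⟨N + 4, hN.trans_le (pow_le_pow_right₀ hs01.le ?_)⟩
    have : 1 * (N + 4 + 1) ≤ (2 * k - 1) * (N + 4 + 1) := Nat.mul_le_mul_right _ (by omega)
    omega
  classical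
  let n := Nat.find hex
  have hn1 : s ^ 2 < s₀ ^ ((2 * k - 1) * (n + 1) - 4) := Nat.find_spec hex
  have hn7 : 7 ≤ n := by
    by_contra hlt
    push Not at hlt
    have h1 : s₀ ^ ((2 * k - 1) * (n + 1) - 4) ≤ s₀ ^ (7 * k * 2) := by
      apply pow_le_pow_right₀ hs01.le
      have : (2 * k - 1) * (n + 1) ≤ (2 * k) * 7 := Nat.mul_le_mul (by omega) (by omega)
      omega
    have h2 : s₀ ^ (7 * k * 2) ≤ s ^ 2 := by
      rw [pow_mul]
      exact pow_le_pow_left₀ (by positivity) hcon 2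
    linarith
  have hn2 : s₀ ^ ((2 * k - 1) * n - 4) ≤ s ^ 2 := by
    have := Nat.find_min hex (m := n - 1) (by omega)
    rw [show n - 1 + 1 = n by omega] at this
    exact not_lt.mp this
  have z1 : (p₀.1 : ℤ) * sxIA k a b n p₀.1 p₀.2 * p.2 - p₀.2 * sxIB k a b n p₀.1 p₀.2 * p.1 = 0 := by
    by_contra hne
    have := key n hne
    have := sx_arith k n n hk hn7 le_rfl (by omega) G s₀ s hG2 hs hspos hn1 hn2
    linarith
  have z2 : (p₀.1 : ℤ) * sxIA k a b (n+1) p₀.1 p₀.2 * p.2 - p₀.2 * sxIB k a b (n+1) p₀.1 p₀.2 * p.1 = 0 := by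
    by_contra hne
    have := key (n+1) hne
    have := sx_arith k n (n+1) hk hn7 (by omega) (by omega) G s₀ s hG2 hs hspos hn1 hn2
    linarith
  -- positivity of the coordinates of p₀
  have L0 := sx_sol_L k a b hk α β hα hβ hαa hβb h₀
  have hGc := (sxG_ge k a b (by omega) ha hb).1
  have hcW : 2 ^ (k - 1) * W < s₀ := by
    have : 2 ^ (k - 1) * W ≤ G := by
      rw [hG]; gcongr
      have : (0:ℝ) ≤ 2 ^ (k - 1) := by positivity
      linarith
    linarith
  have hl0 : |α * p₀.2 - β * p₀.1| < 1 := by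
    by_contra hc
    push Not at hc
    have h1 : s₀ ≤ s₀ ^ (k - 1) := le_self_pow₀ hs01.le (by omega)
    have h2 : s₀ ^ (k - 1) ≤ |α * p₀.2 - β * p₀.1| * s₀ ^ (k - 1) :=
      le_mul_of_one_le_left (by positivity) hc
    linarith
  have hx0 : 0 < p₀.1 := by
    rcases Nat.eq_zero_or_pos p₀.1 with h | h
    · exfalso
      rw [h] at hl0 hs₀
      simp only [Nat.cast_zero, mul_zero, sub_zero, zero_add] at hl0 hs₀
      rw [← hs₀, abs_of_nonneg (by positivity)] at hl0
      nlinarith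
    · exact h
  have hy0 : 0 < p₀.2 := by
    rcases Nat.eq_zero_or_pos p₀.2 with h | h
    · exfalso
      rw [h] at hl0 hs₀
      simp only [Nat.cast_zero, mul_zero, zero_sub, add_zero, abs_neg] at hl0 hs₀
      rw [← hs₀, abs_of_nonneg (by positivity)] at hl0
      nlinarith
    · exact h
  have hbpos : 0 < b := by exact_mod_cast (lt_of_lt_of_le one_pos hb)
  have z1' := congrArg (Int.cast : ℤ → ℝ) z1
  have z2' := congrArg (Int.cast : ℤ → ℝ) z2
  push_cast at z1' z2'
  have hx0' : (0:ℝ) < p₀.1 := by exact_mod_cast hx0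
  have hy0' : (0:ℝ) < p₀.2 := by exact_mod_cast hy0
  set A1 := (sxIA k a b n p₀.1 p₀.2 : ℝ)
  set B1 := (sxIB k a b n p₀.1 p₀.2 : ℝ)
  set A2 := (sxIA k a b (n+1) p₀.1 p₀.2 : ℝ)
  set B2 := (sxIB k a b (n+1) p₀.1 p₀.2 : ℝ)
  have d1 : (p.1 : ℝ) * (A1 * B2 - A2 * B1) = 0 := by
    have : (p₀.2 : ℝ) * ((p.1 : ℝ) * (A1 * B2 - A2 * B1)) = 0 := by
      linear_combination A2 * z1' - A1 * z2'
    exact (mul_eq_zero.mp this).resolve_left hy0'.ne'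
  have d2 : (p.2 : ℝ) * (A1 * B2 - A2 * B1) = 0 := by
    have : (p₀.1 : ℝ) * ((p.2 : ℝ) * (A1 * B2 - A2 * B1)) = 0 := by
      linear_combination B2 * z1' - B1 * z2'
    exact (mul_eq_zero.mp this).resolve_left hx0'.ne'
  have d3 : A1 * B2 - A2 * B1 = 0 := by
    have : s * (A1 * B2 - A2 * B1) = 0 := by rw [hsd]; linear_combination d1 + d2
    exact (mul_eq_zero.mp this).resolve_left hspos.ne'
  have hbx : (b : ℝ) * p₀.1 ^ k ≠ 0 := by positivity
  have hw : ((a : ℝ) * p₀.2 ^ k) / (b * p₀.1 ^ k) ≠ 1 := by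
    intro h1
    rw [div_eq_one_iff_eq hbx] at h1
    exact h₀.2.1 (by rw [h1]; ring)
  apply sx_nondeg k n (by omega) _ hw
  have eA1 := sx_IA_eval k a b n p₀.1 p₀.2 hbpos hx0
  have eB1 := sx_IB_eval k a b n p₀.1 p₀.2 hbpos hx0
  have eA2 := sx_IA_eval k a b (n+1) p₀.1 p₀.2 hbpos hx0
  have eB2 := sx_IB_eval k a b (n+1) p₀.1 p₀.2 hbpos hx0
  set w := ((a : ℝ) * p₀.2 ^ k) / (b * p₀.1 ^ k)
  set v := (b : ℝ) * p₀.1 ^ k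
  have : v ^ n * v ^ (n + 1) * ((sxPA k n).eval w * (sxPB k (n + 1)).eval w - (sxPA k (n + 1)).eval w * (sxPB k n).eval w) = 0 := by
    rw [← d3]
    simp only [A1, A2, B1, B2]
    rw [eA1, eA2, eB1, eB2]
    ring
  exact (mul_eq_zero.mp this).resolve_left (mul_ne_zero (pow_ne_zero _ hbx) (pow_ne_zero _ hbx))

lemma sx_gap (k a b : ℕ) (hk : 3 ≤ k) (α β : ℝ) (hα : 1 ≤ α) (hβ : 1 ≤ β)
    (hαa : α ^ k = a) (hβb : β ^ k = b) (W : ℝ) (hW : 1 ≤ W) (p q : ℕ × ℕ) (hp : sxSol k a b W p)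
    (hq : sxSol k a b W q) (hs : (sxG k a b * W) ^ 4 < (p.1 : ℝ) + p.2)
    (hpq : p ≠ q) (hle : (p.1 : ℝ) + p.2 ≤ (q.1 : ℝ) + q.2) :
    3 / 2 * Real.log ((p.1 : ℝ) + p.2) ≤ Real.log ((q.1 : ℝ) + q.2) := by
  have ha := sx_b_pos k a α hα hαa
  have hb := sx_b_pos k b β hβ hβb
  have hGc := (sxG_ge k a b (by omega) ha hb)
  have Lp := sx_sol_L k a b hk α β hα hβ hαa hβb hp
  have Lq := sx_sol_L k a b hk α β hα hβ hαa hβb hq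
  have hd := sx_det α β hα hβ p q hp.1 hq.1 hpq
  have hc1 : (1:ℝ) ≤ 2 ^ (k - 1) := one_le_pow₀ (by norm_num)
  set c : ℝ := 2 ^ (k - 1)
  have hcW : 1 ≤ c * W := one_le_mul_of_one_le_of_one_le hc1 hW
  have hG : 2 * (c * W) ≤ sxG k a b * W := by rw [← mul_assoc]; gcongr; exact hGc.1
  set G := sxG k a b * W
  have hG1 : 1 ≤ G := by linarith
  have hG4 : 1 ≤ G ^ 4 := one_le_pow₀ hG1
  set s := (p.1 : ℝ) + p.2
  set t := (q.1 : ℝ) + q.2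
  set l := α * p.2 - β * p.1
  set l' := α * q.2 - β * q.1
  have hs1 : 1 < s := by linarith
  have ht1 : 1 < t := by linarith
  have e : k - 1 = (k - 3) + 2 := by omega
  have lp : |l| ≤ c * W / s ^ 2 := by
    rw [le_div_iff₀ (by positivity)]
    refine le_trans ?_ Lp
    gcongr
    · exact hs1.le
    · omega
  have lq : |l'| ≤ c * W / t ^ 2 := by
    rw [le_div_iff₀ (by positivity)]
    refine le_trans ?_ Lq
    gcongr
    · exact ht1.le
    · omega
  have h1 : 1 ≤ 2 * (c * W) * t / s ^ 2 := by
    calc 1 ≤ |l * t - l' * s| := hd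
      _ ≤ |l * t| + |l' * s| := abs_sub _ _
      _ = |l| * t + |l'| * s := by rw [abs_mul, abs_mul, abs_of_pos (by linarith : 0 < t), abs_of_pos (by linarith : 0 < s)]
      _ ≤ c * W / s ^ 2 * t + c * W / s ^ 2 * t := by
          have : c * W / t ^ 2 ≤ c * W / s ^ 2 := by gcongr
          have h3 := lq.trans this
          gcongr
      _ = _ := by ring
  rw [one_le_div (by positivity)] at h1
  have h2 : s ^ 2 ≤ G * t := h1.trans (by gcongr)
  have h3 := Real.log_le_log (by positivity) h2
  rw [Real.log_pow, Real.log_mul (by linarith) (by linarith)] at h3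
  have h4 := Real.log_le_log (by positivity) hs.le
  rw [Real.log_pow] at h4
  have h5 := Real.log_pos hs1
  push_cast at h3 h4
  linarith

lemma sx_large (k a b : ℕ) (hk : 3 ≤ k) (α β : ℝ) (hα : 1 ≤ α) (hβ : 1 ≤ β)
    (hαa : α ^ k = a) (hβb : β ^ k = b) (W : ℝ) (hW : 1 ≤ W) (S : Finset (ℕ × ℕ))
    (hS : ∀ p ∈ S, sxSol k a b W p) (hS1 : ∀ p ∈ S, (sxG k a b * W) ^ 4 < (p.1 : ℝ) + p.2) :
    (S.card : ℝ) ≤ Real.log (7 * k) / Real.log (3 / 2) + 1 := by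
  have hk' : (3:ℝ) ≤ k := by exact_mod_cast hk
  have hlk : 0 ≤ Real.log (7 * k) := Real.log_nonneg (by linarith)
  have hl32 : 0 < Real.log (3 / 2) := Real.log_pos (by norm_num)
  rcases S.eq_empty_or_nonempty with rfl | hne
  · simp; positivity
  obtain ⟨p₀, hp₀, hmin⟩ := Finset.exists_min_image S (fun p => (p.1 : ℝ) + p.2) hne
  have ha := sx_b_pos k a α hα hαa
  have hb := sx_b_pos k b β hβ hβb
  have hG2 : 1 ≤ (sxG k a b * W) ^ 4 := by
    have := (sxG_ge k a b (by omega) ha hb).2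
    exact one_le_pow₀ (by nlinarith)
  have hlog : ∀ p ∈ S, 0 < Real.log ((p.1 : ℝ) + p.2) := fun p hp =>
    Real.log_pos (by linarith [hS1 p hp])
  have hsep : ∀ p ∈ S, ∀ q ∈ S, p ≠ q → (p.1 : ℝ) + p.2 ≤ (q.1 : ℝ) + q.2 →
      Real.log (3 / 2) ≤ Real.log (Real.log ((q.1 : ℝ) + q.2)) - Real.log (Real.log ((p.1 : ℝ) + p.2)) := by
    intro p hp q hq hpq hle
    have h1 := sx_gap k a b hk α β hα hβ hαa hβb W hW p q (hS p hp) (hS q hq) (hS1 p hp) hpq hle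
    have h2 := Real.log_le_log (by have := hlog p hp; positivity) h1
    rw [Real.log_mul (by norm_num) (hlog p hp).ne'] at h2
    linarith
  apply sx_sep S (fun p => Real.log (Real.log ((p.1 : ℝ) + p.2))) (Real.log (Real.log ((p₀.1 : ℝ) + p₀.2)))
    (Real.log (7 * k)) (Real.log (3 / 2)) hl32 hlk
  · intro p hp
    constructor
    · apply Real.log_le_log (hlog p₀ hp₀)
      apply Real.log_le_log (by linarith [hS1 p₀ hp₀])
      exact hmin p hp
    · have hpos : (0:ℝ) < (p.1 : ℝ) + p.2 := by linarith [hS1 p hp]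
      have h1 := sx_exclusion k a b hk α β hα hβ hαa hβb W hW p₀ p (hS p₀ hp₀) (hS p hp) (hS1 p₀ hp₀)
        (by exact_mod_cast hpos)
      have h2 := Real.log_le_log hpos h1.le
      rw [Real.log_pow] at h2
      have h3 := Real.log_le_log (hlog p hp) h2
      rw [Real.log_mul (by positivity) (hlog p₀ hp₀).ne'] at h3
      push_cast at h3
      linarith
  · intro p hp q hq hpq
    rcases le_total ((p.1 : ℝ) + p.2) ((q.1 : ℝ) + q.2) with hle | hle
    · rw [abs_sub_comm]
      exact (hsep p hp q hq hpq hle).trans (le_abs_self _)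
    · exact (hsep q hq p hp hpq.symm hle).trans (le_abs_self _)

lemma sx_primitive (k a b : ℕ) (hk : 3 ≤ k) (ha : 1 ≤ a) (hb : 1 ≤ b) :
    ∃ C : ℝ, 0 < C ∧ ∀ (W M : ℝ), 1 ≤ W → 1 ≤ M → ∀ S : Finset (ℕ × ℕ),
      (∀ p ∈ S, sxSol k a b W p) → (∀ p ∈ S, M < (p.1 : ℝ) + p.2) →
      (S.card : ℝ) ≤ C * (1 + Real.log W + W / M ^ (k - 2)) := by
  have ha' : (1:ℝ) ≤ a := by exact_mod_cast ha
  have hb' : (1:ℝ) ≤ b := by exact_mod_cast hb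
  set α : ℝ := (a : ℝ) ^ ((k : ℝ)⁻¹) with hα
  set β : ℝ := (b : ℝ) ^ ((k : ℝ)⁻¹) with hβ
  have hαa : α ^ k = a := Real.rpow_inv_natCast_pow (by positivity) (by omega)
  have hβb : β ^ k = b := Real.rpow_inv_natCast_pow (by positivity) (by omega)
  have hα1 : 1 ≤ α := Real.one_le_rpow ha' (by positivity)
  have hβ1 : 1 ≤ β := Real.one_le_rpow hb' (by positivity)
  have hG2 := (sxG_ge k a b (by omega) ha' hb').2
  set G := sxG k a b
  have hk' : (3:ℝ) ≤ k := by exact_mod_cast hk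
  have hlk : 0 ≤ Real.log (7 * k) := Real.log_nonneg (by linarith)
  have hl32 : 0 < Real.log (3 / 2) := Real.log_pos (by norm_num)
  have hl2 : 0 < Real.log 2 := Real.log_pos (by norm_num)
  set N := Real.log (7 * k) / Real.log (3 / 2) + 1 with hN
  have hN1 : 1 ≤ N := by rw [hN]; have : 0 ≤ Real.log (7 * k) / Real.log (3 / 2) := by positivity
                         linarith
  have hlG : 0 ≤ Real.log G := Real.log_nonneg (by linarith)
  set c : ℝ := 16 * 2 ^ (k - 1) with hc
  have hc0 : 0 < c := by positivity
  refine ⟨N + 1 + 4 * Real.log G / Real.log 2 + 4 / Real.log 2 + c, by positivity, ?_⟩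
  intro W M hW hM S hS hSM
  have hlW : 0 ≤ Real.log W := Real.log_nonneg hW
  classical
  rw [← Finset.card_filter_add_card_filter_not (s := S) (fun p => (p.1 : ℝ) + p.2 ≤ (G * W) ^ 4)]
  have i2 := sx_large k a b hk α β hα1 hβ1 hαa hβb W hW
    (S.filter (fun p => ¬ (p.1 : ℝ) + p.2 ≤ (G * W) ^ 4))
    (fun p hp => hS p (Finset.mem_filter.mp hp).1) (fun p hp => not_le.mp (Finset.mem_filter.mp hp).2)
  set x : ℝ := Real.log ((G * W) ^ 4) / Real.log 2 with hx
  have hxe : x = 4 * Real.log G / Real.log 2 + 4 / Real.log 2 * Real.log W := by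
    rw [hx, Real.log_pow, Real.log_mul (by linarith) (by linarith)]; push_cast; ring
  have hx0 : 0 ≤ x := by rw [hxe]; positivity
  have hm : (G * W) ^ 4 ≤ 2 ^ ⌈x⌉₊ := by
    have h1 : Real.log ((G * W) ^ 4) ≤ Real.log (2 ^ ⌈x⌉₊) := by
      have h2 := Nat.le_ceil x
      have h3 : Real.log ((G * W) ^ 4) = x * Real.log 2 := by
        rw [hx, div_mul_cancel₀ _ hl2.ne']
      have h4 : Real.log ((2:ℝ) ^ ⌈x⌉₊) = ⌈x⌉₊ * Real.log 2 := Real.log_pow _ _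
      rw [h3, h4]
      exact mul_le_mul_of_nonneg_right h2 hl2.le
    exact (Real.log_le_log_iff (by positivity) (by positivity)).mp h1
  have i1 := sx_medium k a b hk α β hα1 hβ1 hαa hβb W M (by linarith) (by linarith) ⌈x⌉₊
    (S.filter (fun p => (p.1 : ℝ) + p.2 ≤ (G * W) ^ 4))
    (fun p hp => hS p (Finset.mem_filter.mp hp).1) (fun p hp => hSM p (Finset.mem_filter.mp hp).1)
    (fun p hp => (Finset.mem_filter.mp hp).2.trans (hm.trans (le_mul_of_one_le_right (by positivity) hM)))
  have hceil := Nat.ceil_lt_add_one hx0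
  have hV : 0 ≤ W / M ^ (k - 2) := by positivity
  have i1' : 16 * 2 ^ (k - 1) * W / M ^ (k - 2) * (1 - (1 / 2) ^ ⌈x⌉₊) ≤ c * (W / M ^ (k - 2)) := by
    rw [← hc, mul_div_assoc]
    apply mul_le_of_le_one_right (by positivity)
    have : (0:ℝ) ≤ (1 / 2) ^ ⌈x⌉₊ := by positivity
    linarith
  push_cast
  set V := W / M ^ (k - 2)
  set g := 4 * Real.log G / Real.log 2
  set l4 := 4 / Real.log 2
  have hg : 0 ≤ g := by positivity
  have hl4 : 0 ≤ l4 := by positivity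
  set L := Real.log W
  have e : (N + 1 + g + l4 + c) * (1 + L + V) = (N + 1 + g + l4 * L + c * V) +
    ((N + 1 + g) * (L + V) + l4 * (1 + V) + c * (1 + L)) := by ring
  have e2 : 0 ≤ ((N + 1 + g) * (L + V) + l4 * (1 + V) + c * (1 + L)) := by positivity
  rw [e]
  linarith

/-- Partial sums of `1 / d ^ 2` are at most two. -/
lemma sx_sum_inv_sq (D : ℕ) : ∑ d ∈ Finset.Icc 1 (D + 1), (1:ℝ) / (d:ℝ) ^ 2 ≤ 2 - 1 / (D + 1) := by
  induction D with
  | zero => simp; norm_num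
  | succ n ih =>
    rw [Finset.sum_Icc_succ_top (by omega)]
    push_cast
    have h : (1:ℝ) / ((n:ℝ) + 1 + 1) ^ 2 ≤ 1 / ((n:ℝ) + 1) - 1 / ((n:ℝ) + 1 + 1) := by
      rw [div_sub_div _ _ (by positivity) (by positivity), div_le_div_iff₀ (by positivity) (by positivity)]
      nlinarith [(Nat.cast_nonneg n : (0:ℝ) ≤ n)]
    linarith

lemma sx_core_big (k a b : ℕ) (hk : 3 ≤ k) (ha : 1 ≤ a) (hb : 1 ≤ b) :
    ∃ C : ℝ, 0 < C ∧ ∀ Z γ : ℝ, 2 ≤ Z → 1 / (k : ℝ) < γ → ∀ S : Finset (ℕ × ℕ),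
      (∀ p ∈ S, (a:ℝ) * (p.2:ℝ) ^ k - b * (p.1:ℝ) ^ k ≠ 0 ∧
        |(a:ℝ) * (p.2:ℝ) ^ k - b * (p.1:ℝ) ^ k| ≤ Z ∧ Z ^ γ < (p.1:ℝ) + p.2) →
      (S.card : ℝ) ≤ C * (Z ^ ((1 : ℝ) / k) * Real.log Z + Z ^ (1 - ((k : ℝ) - 2) * γ)) := by
  obtain ⟨C, hC, hprim⟩ := sx_primitive k a b hk ha hb
  have hl2 : 0 < Real.log 2 := Real.log_pos (by norm_num)
  refine ⟨C * (1 / Real.log 2 + 2), by positivity, ?_⟩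
  intro Z γ hZ hγ S hS
  have hk0 : (0:ℝ) < k := by positivity
  have hZ0 : 0 < Z := by linarith
  set R : ℝ := Z ^ ((1 : ℝ) / k) with hR
  have hR0 : 0 < R := by positivity
  have hRk : R ^ k = Z := by
    rw [hR, one_div]
    exact Real.rpow_inv_natCast_pow hZ0.le (by omega)
  set E : ℝ := Z ^ (1 - ((k : ℝ) - 2) * γ) with hE
  have hE0 : 0 < E := by positivity
  have hRγ : R ≤ Z ^ γ := Real.rpow_le_rpow_of_exponent_le (by linarith) hγ.le
  have hT0 : 0 < Z ^ γ := by positivity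
  have hET : E = Z / (Z ^ γ) ^ (k - 2) := by
    rw [hE, Real.rpow_sub hZ0, Real.rpow_one, ← Real.rpow_natCast, ← Real.rpow_mul hZ0.le]
    congr 2
    rw [Nat.cast_sub (by omega)]; push_cast; ring
  have hgpos : ∀ p ∈ S, 0 < p.1.gcd p.2 := by
    intro p hp
    rcases Nat.eq_zero_or_pos (p.1.gcd p.2) with h | h
    · exfalso
      rw [Nat.gcd_eq_zero_iff] at h
      apply (hS p hp).1
      rw [h.1, h.2]
      have : k ≠ 0 := by omega
      simp [this]
    · exact h
  have hfact : ∀ p ∈ S, ((a:ℝ) * (p.2:ℝ) ^ k - b * (p.1:ℝ) ^ k) = ((p.1.gcd p.2 : ℕ) : ℝ) ^ k *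
      ((a:ℝ) * ((p.2 / p.1.gcd p.2 : ℕ):ℝ) ^ k - b * ((p.1 / p.1.gcd p.2 : ℕ):ℝ) ^ k) := by
    intro p hp
    have h1 : (p.1:ℝ) = ((p.1.gcd p.2 : ℕ) : ℝ) * ((p.1 / p.1.gcd p.2 : ℕ):ℝ) := by
      rw [← Nat.cast_mul, Nat.mul_div_cancel' (Nat.gcd_dvd_left _ _)]
    have h2 : (p.2:ℝ) = ((p.1.gcd p.2 : ℕ) : ℝ) * ((p.2 / p.1.gcd p.2 : ℕ):ℝ) := by
      rw [← Nat.cast_mul, Nat.mul_div_cancel' (Nat.gcd_dvd_right _ _)]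
    generalize p.1.gcd p.2 = g at *
    generalize p.1 / g = u at *
    generalize p.2 / g = v at *
    rw [h1, h2]; ring
  have hone : ∀ x y : ℕ, (a:ℝ) * (y:ℝ) ^ k - b * (x:ℝ) ^ k ≠ 0 →
      1 ≤ |(a:ℝ) * (y:ℝ) ^ k - b * (x:ℝ) ^ k| := by
    intro x y h
    have h1 : ((a:ℤ) * (y:ℤ) ^ k - b * (x:ℤ) ^ k) ≠ 0 := by
      intro h2; apply h; exact_mod_cast h2
    have h3 := Int.one_le_abs h1
    exact_mod_cast h3
  have hgR : ∀ p ∈ S, ((p.1.gcd p.2 : ℕ) : ℝ) ≤ R := by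
    intro p hp
    have h1 := hS p hp
    rw [hfact p hp] at h1
    have h2 := hone _ _ (right_ne_zero_of_mul h1.1)
    have h3 := h1.2.1
    rw [abs_mul, abs_of_nonneg (by positivity)] at h3
    have h4 : ((p.1.gcd p.2 : ℕ) : ℝ) ^ k ≤ R ^ k := by
      rw [hRk]
      refine le_trans ?_ h3
      exact le_mul_of_one_le_right (by positivity) h2
    exact le_of_pow_le_pow_left₀ (by omega) hR0.le h4
  have hmaps : ∀ p ∈ S, p.1.gcd p.2 ∈ Finset.Icc 1 ⌊R⌋₊ := by
    intro p hp
    rw [Finset.mem_Icc]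
    exact ⟨hgpos p hp, Nat.le_floor (hgR p hp)⟩
  have hfib : ∀ d ∈ Finset.Icc 1 ⌊R⌋₊, ((S.filter (fun p => p.1.gcd p.2 = d)).card : ℝ) ≤
      C * (1 + Real.log Z + E * (1 / (d:ℝ) ^ 2)) := by
    intro d hd
    rw [Finset.mem_Icc] at hd
    have hd1 : (1:ℝ) ≤ d := by exact_mod_cast hd.1
    have hd0 : (0:ℝ) < d := by linarith
    have hdR : (d:ℝ) ≤ R := (Nat.le_floor_iff hR0.le).mp hd.2
    have hdk : (d:ℝ) ^ k ≤ Z := by rw [← hRk]; gcongr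
    have hW : 1 ≤ Z / (d:ℝ) ^ k := by rw [one_le_div (by positivity)]; exact hdk
    have hM : 1 ≤ Z ^ γ / d := by rw [one_le_div hd0]; exact hdR.trans hRγ
    have hinj : Set.InjOn (fun p : ℕ × ℕ => (p.1 / d, p.2 / d))
        (S.filter (fun p => p.1.gcd p.2 = d) : Finset (ℕ × ℕ)) := by
      intro p hp q hq hpq
      simp only [Finset.coe_filter, Set.mem_ofPred_eq] at hp hq
      simp only [Prod.mk.injEq] at hpq
      have e1 := Nat.mul_div_cancel' (Nat.gcd_dvd_left p.1 p.2)
      have e2 := Nat.mul_div_cancel' (Nat.gcd_dvd_right p.1 p.2)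
      have e3 := Nat.mul_div_cancel' (Nat.gcd_dvd_left q.1 q.2)
      have e4 := Nat.mul_div_cancel' (Nat.gcd_dvd_right q.1 q.2)
      rw [hp.2] at e1 e2
      rw [hq.2] at e3 e4
      ext
      · rw [← e1, ← e3, hpq.1]
      · rw [← e2, ← e4, hpq.2]
    rw [← Finset.card_image_of_injOn hinj]
    have key := hprim (Z / (d:ℝ) ^ k) (Z ^ γ / d) hW hM
      ((S.filter (fun p => p.1.gcd p.2 = d)).image (fun p : ℕ × ℕ => (p.1 / d, p.2 / d))) ?_ ?_
    · refine key.trans ?_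
      have h1 : Z / (d:ℝ) ^ k / (Z ^ γ / d) ^ (k - 2) = E * (1 / (d:ℝ) ^ 2) := by
        rw [hET, div_pow]
        have : (d:ℝ) ^ k = (d:ℝ) ^ (k - 2) * (d:ℝ) ^ 2 := by
          rw [← pow_add]; congr 1; omega
        rw [this]
        field_simp
      rw [h1]
      have h2 : Real.log (Z / (d:ℝ) ^ k) ≤ Real.log Z := by
        apply Real.log_le_log (by positivity)
        exact div_le_self hZ0.le (one_le_pow₀ hd1)
      gcongr
    · intro q hq
      obtain ⟨p, hp, rfl⟩ := Finset.mem_image.mp hq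
      rw [Finset.mem_filter] at hp
      have h1 := hS p hp.1
      rw [hfact p hp.1] at h1
      have hg := hgpos p hp.1
      have hcop := Nat.coprime_div_gcd_div_gcd hg
      rw [hp.2] at h1 hcop
      refine ⟨hcop, right_ne_zero_of_mul h1.1, ?_⟩
      have h3 := h1.2.1
      rw [abs_mul, abs_of_nonneg (by positivity)] at h3
      rw [le_div_iff₀ (by positivity), mul_comm]
      exact h3
    · intro q hq
      obtain ⟨p, hp, rfl⟩ := Finset.mem_image.mp hq
      rw [Finset.mem_filter] at hp
      have h1 := (hS p hp.1).2.2
      have e1 := Nat.mul_div_cancel' (Nat.gcd_dvd_left p.1 p.2)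
      have e2 := Nat.mul_div_cancel' (Nat.gcd_dvd_right p.1 p.2)
      rw [hp.2] at e1 e2
      rw [div_lt_iff₀ hd0]
      have e1' : (d:ℝ) * ((p.1 / d : ℕ) : ℝ) = p.1 := by exact_mod_cast e1
      have e2' : (d:ℝ) * ((p.2 / d : ℕ) : ℝ) = p.2 := by exact_mod_cast e2
      have : (((p.1 / d : ℕ) : ℝ) + ((p.2 / d : ℕ) : ℝ)) * d = p.1 + p.2 := by
        rw [← e1', ← e2']; ring
      rw [this]
      exact h1
  rw [Finset.card_eq_sum_card_fiberwise hmaps]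
  push_cast
  refine (Finset.sum_le_sum hfib).trans ?_
  rw [← Finset.mul_sum, Finset.sum_add_distrib, Finset.sum_const, ← Finset.mul_sum, Nat.card_Icc,
    nsmul_eq_mul, Nat.add_sub_cancel, mul_assoc]
  have hs' : ∑ d ∈ Finset.Icc 1 ⌊R⌋₊, (1:ℝ) / (d:ℝ) ^ 2 ≤ 2 := by
    have hsub : Finset.Icc 1 ⌊R⌋₊ ⊆ Finset.Icc 1 (⌊R⌋₊ + 1) :=
      Finset.Icc_subset_Icc le_rfl (by omega)
    refine (Finset.sum_le_sum_of_subset_of_nonneg hsub (fun d _ _ => by positivity)).trans ?_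
    refine (sx_sum_inv_sq ⌊R⌋₊).trans ?_
    have : (0:ℝ) ≤ 1 / ((⌊R⌋₊:ℝ) + 1) := by positivity
    linarith
  have hfl := Nat.floor_le hR0.le
  have hlZ : Real.log 2 ≤ Real.log Z := Real.log_le_log (by norm_num) hZ
  have h1 : 1 + Real.log Z ≤ (1 / Real.log 2 + 2) * Real.log Z := by
    have : 1 ≤ 1 / Real.log 2 * Real.log Z := by
      rw [one_div, inv_mul_eq_div, one_le_div hl2]; exact hlZ
    nlinarith
  have h2 : (⌊R⌋₊:ℝ) * (1 + Real.log Z) ≤ R * ((1 / Real.log 2 + 2) * Real.log Z) := by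
    have : 0 ≤ 1 + Real.log Z := by linarith
    gcongr
  have h3 : E * ∑ d ∈ Finset.Icc 1 ⌊R⌋₊, (1:ℝ) / (d:ℝ) ^ 2 ≤ (1 / Real.log 2 + 2) * E := by
    have : 0 < 1 / Real.log 2 := by positivity
    nlinarith
  refine mul_le_mul_of_nonneg_left ?_ hC.le
  linarith

lemma sx_core_small (k a b : ℕ) (hk : 3 ≤ k) (ha : 1 ≤ a) (hb : 1 ≤ b) :
    ∃ C : ℝ, 0 < C ∧ ∀ Z γ : ℝ, 1 ≤ Z → Z < 2 → 1 / (k : ℝ) < γ → ∀ S : Finset (ℕ × ℕ),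
      (∀ p ∈ S, (a:ℝ) * (p.2:ℝ) ^ k - b * (p.1:ℝ) ^ k ≠ 0 ∧
        |(a:ℝ) * (p.2:ℝ) ^ k - b * (p.1:ℝ) ^ k| ≤ Z ∧ Z ^ γ < (p.1:ℝ) + p.2) →
      (S.card : ℝ) ≤ C * (Z ^ ((1 : ℝ) / k) * Real.log Z + Z ^ (1 - ((k : ℝ) - 2) * γ)) := by
  obtain ⟨C, hC, hprim⟩ := sx_primitive k a b hk ha hb
  have hb2 : ∀ S : Finset (ℕ × ℕ), (∀ p ∈ S, sxSol k a b 1 p ∧ (1:ℝ) < (p.1:ℝ) + p.2) →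
      (S.card : ℝ) ≤ C * 2 := by
    intro S hS
    have := hprim 1 1 le_rfl le_rfl S (fun p hp => (hS p hp).1) (fun p hp => (hS p hp).2)
    norm_num at this
    exact this
  set T : Set (ℕ × ℕ) := {p | sxSol k a b 1 p ∧ (1:ℝ) < (p.1:ℝ) + p.2} with hT
  have hfin : T.Finite := by
    by_contra hinf
    obtain ⟨S, hST, hcard⟩ := Set.Infinite.exists_subset_card_eq hinf (⌈C * 2⌉₊ + 1)
    have h1 := hb2 S (fun p hp => hST hp)
    rw [hcard] at h1
    have h2 := Nat.le_ceil (C * 2)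
    push_cast at h1
    linarith
  obtain ⟨H, hH⟩ : ∃ H : ℕ, ∀ p ∈ T, p.1 + p.2 ≤ H := by
    refine ⟨hfin.toFinset.sup (fun p => p.1 + p.2), fun p hp => ?_⟩
    exact Finset.le_sup (f := fun p : ℕ × ℕ => p.1 + p.2) (hfin.mem_toFinset.mpr hp)
  refine ⟨C * 2 * ((H:ℝ) + 1) ^ (k - 2), by positivity, ?_⟩
  intro Z γ hZ hZ2 hγ S hS
  have hZ0 : 0 < Z := by linarith
  have hk0 : (0:ℝ) < k := by positivity
  have hγ0 : 0 < γ := lt_trans (by positivity) hγ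
  have hT1 : 1 ≤ Z ^ γ := Real.one_le_rpow hZ hγ0.le
  have hlog : 0 ≤ Real.log Z := Real.log_nonneg hZ
  have hST : ∀ p ∈ S, p ∈ T := by
    intro p hp
    obtain ⟨h1, h2, h3⟩ := hS p hp
    have h4 : ((a:ℤ) * (p.2:ℤ) ^ k - b * (p.1:ℤ) ^ k) ≠ 0 := by
      intro h; apply h1; exact_mod_cast h
    have h5 : |((a:ℤ) * (p.2:ℤ) ^ k - b * (p.1:ℤ) ^ k)| < 2 := by
      have := h2.trans_lt hZ2
      exact_mod_cast this
    have h6 : |((a:ℤ) * (p.2:ℤ) ^ k - b * (p.1:ℤ) ^ k)| = 1 := by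
      have := Int.one_le_abs h4
      omega
    refine ⟨⟨?_, h1, ?_⟩, lt_of_le_of_lt hT1 h3⟩
    · have hd1 : ((p.1.gcd p.2 : ℕ) : ℤ) ∣ ((a:ℤ) * (p.2:ℤ) ^ k - b * (p.1:ℤ) ^ k) := by
        apply dvd_sub
        · exact Dvd.dvd.mul_left (dvd_pow (Int.natCast_dvd_natCast.mpr (Nat.gcd_dvd_right _ _)) (by omega)) _
        · exact Dvd.dvd.mul_left (dvd_pow (Int.natCast_dvd_natCast.mpr (Nat.gcd_dvd_left _ _)) (by omega)) _
      rw [← dvd_abs, h6] at hd1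
      have : p.1.gcd p.2 ∣ 1 := by exact_mod_cast hd1
      exact Nat.dvd_one.mp this
    · have := h6.le
      exact_mod_cast this
  have hcard := hb2 S hST
  rcases S.eq_empty_or_nonempty with he | ⟨p, hp⟩
  · rw [he]; simp only [Finset.card_empty, Nat.cast_zero]; positivity
  · have h1 : Z ^ γ ≤ (H:ℝ) + 1 := by
      have h2 := (hS p hp).2.2
      have h3 : ((p.1:ℝ) + p.2) ≤ H := by exact_mod_cast hH p (hST p hp)
      linarith
    have hET : Z ^ (1 - ((k : ℝ) - 2) * γ) = Z / (Z ^ γ) ^ (k - 2) := by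
      rw [Real.rpow_sub hZ0, Real.rpow_one, ← Real.rpow_natCast, ← Real.rpow_mul hZ0.le]
      congr 2
      rw [Nat.cast_sub (by omega)]; push_cast; ring
    have h2 : 1 ≤ ((H:ℝ) + 1) ^ (k - 2) * Z ^ (1 - ((k : ℝ) - 2) * γ) := by
      rw [hET, ← mul_div_assoc, one_le_div (by positivity)]
      calc (Z ^ γ) ^ (k - 2) ≤ ((H:ℝ) + 1) ^ (k - 2) := by gcongr
        _ ≤ _ := le_mul_of_one_le_right (by positivity) hZ
    calc (S.card : ℝ) ≤ C * 2 * 1 := by linarith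
      _ ≤ C * 2 * (((H:ℝ) + 1) ^ (k - 2) * Z ^ (1 - ((k : ℝ) - 2) * γ)) := by gcongr
      _ = C * 2 * ((H:ℝ) + 1) ^ (k - 2) * (0 + Z ^ (1 - ((k : ℝ) - 2) * γ)) := by ring
      _ ≤ _ := by
        gcongr
        positivity

lemma sx_core (k a b : ℕ) (hk : 3 ≤ k) (ha : 1 ≤ a) (hb : 1 ≤ b) :
    ∃ C : ℝ, 0 < C ∧ ∀ Z γ : ℝ, 1 ≤ Z → 1 / (k : ℝ) < γ → ∀ S : Finset (ℕ × ℕ),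
      (∀ p ∈ S, (a:ℝ) * (p.2:ℝ) ^ k - b * (p.1:ℝ) ^ k ≠ 0 ∧
        |(a:ℝ) * (p.2:ℝ) ^ k - b * (p.1:ℝ) ^ k| ≤ Z ∧ Z ^ γ < (p.1:ℝ) + p.2) →
      (S.card : ℝ) ≤ C * (Z ^ ((1 : ℝ) / k) * Real.log Z + Z ^ (1 - ((k : ℝ) - 2) * γ)) := by
  obtain ⟨C₁, hC₁, h₁⟩ := sx_core_big k a b hk ha hb
  obtain ⟨C₂, hC₂, h₂⟩ := sx_core_small k a b hk ha hb
  refine ⟨C₁ + C₂, by positivity, fun Z γ hZ hγ S hS => ?_⟩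
  have hlog : 0 ≤ Real.log Z := Real.log_nonneg hZ
  have hZ0 : 0 < Z := by linarith
  have hpos : 0 ≤ Z ^ ((1 : ℝ) / k) * Real.log Z + Z ^ (1 - ((k : ℝ) - 2) * γ) := by positivity
  rcases lt_or_ge Z 2 with h | h
  · have := h₂ Z γ hZ h hγ S hS
    nlinarith
  · have := h₁ Z γ h hγ S hS
    nlinarith

/-- Passing to absolute values of the coordinates. -/
lemma sx_abs (k : ℕ) (hk : 3 ≤ k) (n₁ n₂ : ℤ) (hn₁ : n₁ ≠ 0) (hn₂ : n₂ ≠ 0) (Z γ : ℝ)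
    (hZ : 1 ≤ Z) (hγ : 1 / (k : ℝ) < γ) (p : ℤ × ℤ)
    (h0 : 0 < |n₁ * p.2 ^ k - n₂ * p.1 ^ k|)
    (h1 : (|n₁ * p.2 ^ k - n₂ * p.1 ^ k| : ℝ) ≤ Z)
    (h2 : Z ^ γ < ((max |p.1| |p.2| : ℤ) : ℝ)) :
    ((n₁.natAbs : ℕ) : ℝ) * ((p.2.natAbs : ℕ) : ℝ) ^ k
        - ((n₂.natAbs : ℕ) : ℝ) * ((p.1.natAbs : ℕ) : ℝ) ^ k ≠ 0 ∧
      |((n₁.natAbs : ℕ) : ℝ) * ((p.2.natAbs : ℕ) : ℝ) ^ k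
        - ((n₂.natAbs : ℕ) : ℝ) * ((p.1.natAbs : ℕ) : ℝ) ^ k| ≤ Z ∧
      Z ^ γ < ((p.1.natAbs : ℕ) : ℝ) + ((p.2.natAbs : ℕ) : ℝ) := by
  obtain ⟨x, y⟩ := p
  simp only [Nat.cast_natAbs, Int.cast_abs] at *
  have hZ0 : 0 < Z := by linarith
  have hmx : (|x|:ℤ) ≤ |x| + |y| := by have := abs_nonneg y; linarith
  have hmy : (|y|:ℤ) ≤ |x| + |y| := by have := abs_nonneg x; linarith
  have hxr : (0:ℝ) ≤ |(x:ℝ)| := abs_nonneg _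
  have hyr : (0:ℝ) ≤ |(y:ℝ)| := abs_nonneg _
  have hmax : ((max |x| |y| : ℤ) : ℝ) = max |(x:ℝ)| |(y:ℝ)| := by push_cast; rfl
  rw [hmax] at h2
  have hU : |(n₁:ℝ)| * |(y:ℝ)| ^ k = |(n₁:ℝ) * (y:ℝ) ^ k| := by rw [abs_mul, abs_pow]
  have hV : |(n₂:ℝ)| * |(x:ℝ)| ^ k = |(n₂:ℝ) * (x:ℝ) ^ k| := by rw [abs_mul, abs_pow]
  refine ⟨?_, ?_, ?_⟩
  · intro h
    rw [sub_eq_zero] at h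
    have h' := h
    rw [hU, hV] at h'
    rcases abs_eq_abs.mp h' with h3 | h3
    · have h4 : n₁ * y ^ k = n₂ * x ^ k := by exact_mod_cast h3
      rw [h4] at h0
      simp at h0
    · have hN1 : (1:ℝ) ≤ |(n₁:ℝ)| := by exact_mod_cast Int.one_le_abs hn₁
      have hN2 : (1:ℝ) ≤ |(n₂:ℝ)| := by exact_mod_cast Int.one_le_abs hn₂
      have h4 : |(n₁:ℝ) * (y:ℝ) ^ k - n₂ * (x:ℝ) ^ k| =
          |(n₁:ℝ)| * |(y:ℝ)| ^ k + |(n₂:ℝ)| * |(x:ℝ)| ^ k := by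
        rw [h, hV, h3, ← abs_neg, ← two_mul]
        rw [show -(-((n₂:ℝ) * (x:ℝ) ^ k) - n₂ * (x:ℝ) ^ k) = 2 * (n₂ * (x:ℝ) ^ k) by ring, abs_mul]
        norm_num
      have h5 : Z < (max |(x:ℝ)| |(y:ℝ)|) ^ k := by
        have h6 : Z ^ ((1:ℝ) / k) < max |(x:ℝ)| |(y:ℝ)| :=
          lt_of_le_of_lt (Real.rpow_le_rpow_of_exponent_le hZ hγ.le) h2
        have h7 : (Z ^ ((1:ℝ) / k)) ^ k = Z := by
          rw [one_div]; exact Real.rpow_inv_natCast_pow hZ0.le (by omega)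
        calc Z = (Z ^ ((1:ℝ) / k)) ^ k := h7.symm
          _ < _ := pow_lt_pow_left₀ h6 (by positivity) (by omega)
      have h8 : (max |(x:ℝ)| |(y:ℝ)|) ^ k ≤ |(y:ℝ)| ^ k + |(x:ℝ)| ^ k := by
        have a1 : 0 ≤ |(y:ℝ)| ^ k := by positivity
        have a2 : 0 ≤ |(x:ℝ)| ^ k := by positivity
        rcases max_cases |(x:ℝ)| |(y:ℝ)| with h9 | h9 <;> rw [h9.1] <;> linarith
      have h10 : |(y:ℝ)| ^ k ≤ |(n₁:ℝ)| * |(y:ℝ)| ^ k := le_mul_of_one_le_left (by positivity) hN1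
      have h11 : |(x:ℝ)| ^ k ≤ |(n₂:ℝ)| * |(x:ℝ)| ^ k := le_mul_of_one_le_left (by positivity) hN2
      linarith
  · rw [hU, hV]
    exact (abs_abs_sub_abs_le_abs_sub _ _).trans h1
  · refine h2.trans_le (max_le ?_ ?_) <;> linarith

/-- Stewart–Xiao / Heath-Brown counting: for `F(x,y) = n₁y^k − n₂x^k` of degree `k ≥ 3`
with `n₁, n₂ ≠ 0` (so that `F` has nonzero discriminant), `Z ≥ 1` and `γ > 1/k`, the
number of integer pairs `(x,y)` with `0 < |F(x,y)| ≤ Z` and `max{|x|,|y|} > Z^γ` is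
`O_F(Z^{1/k} log Z + Z^{1−(k−2)γ})`. -/
theorem stewart_xiao_count (k : ℕ) (hk : 3 ≤ k) (n₁ n₂ : ℤ) (hn₁ : n₁ ≠ 0)
    (hn₂ : n₂ ≠ 0) :
    ∃ C > 0, ∀ Z γ : ℝ, 1 ≤ Z → 1 / (k : ℝ) < γ →
      ({p : ℤ × ℤ | 0 < |n₁ * p.2 ^ k - n₂ * p.1 ^ k| ∧
          (|n₁ * p.2 ^ k - n₂ * p.1 ^ k| : ℝ) ≤ Z ∧
          Z ^ γ < ((max |p.1| |p.2| : ℤ) : ℝ)}.ncard : ℝ)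
        ≤ C * (Z ^ ((1 : ℝ) / k) * Real.log Z + Z ^ (1 - ((k : ℝ) - 2) * γ)) := by
  obtain ⟨C, hC, hcore⟩ := sx_core k n₁.natAbs n₂.natAbs hk (Int.natAbs_pos.mpr hn₁)
    (Int.natAbs_pos.mpr hn₂)
  refine ⟨4 * C, by positivity, ?_⟩
  intro Z γ hZ hγ
  have hZ0 : 0 < Z := by linarith
  have hlog : 0 ≤ Real.log Z := Real.log_nonneg hZ
  set T : Set (ℤ × ℤ) := {p : ℤ × ℤ | 0 < |n₁ * p.2 ^ k - n₂ * p.1 ^ k| ∧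
          (|n₁ * p.2 ^ k - n₂ * p.1 ^ k| : ℝ) ≤ Z ∧
          Z ^ γ < ((max |p.1| |p.2| : ℤ) : ℝ)} with hT
  rcases T.finite_or_infinite with hfin | hinf
  · rw [Set.ncard_eq_toFinset_card T hfin]
    have hle : hfin.toFinset.card ≤
        4 * (hfin.toFinset.image (fun p : ℤ × ℤ => (p.1.natAbs, p.2.natAbs))).card := by
      apply Finset.card_le_mul_card_image
      intro q _
      calc _ ≤ (({(q.1:ℤ), -(q.1:ℤ)} : Finset ℤ) ×ˢ ({(q.2:ℤ), -(q.2:ℤ)} : Finset ℤ)).card := by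
            apply Finset.card_le_card
            intro p hp
            have h := (Finset.mem_filter.mp hp).2
            rw [← h]
            simp only [Finset.mem_product, Finset.mem_insert, Finset.mem_singleton]
            constructor <;> omega
        _ ≤ 2 * 2 := by
            rw [Finset.card_product]
            exact Nat.mul_le_mul Finset.card_le_two Finset.card_le_two
        _ = 4 := by norm_num
    have hc := hcore Z γ hZ hγ
      (hfin.toFinset.image (fun p : ℤ × ℤ => (p.1.natAbs, p.2.natAbs))) (by
        intro q hq
        obtain ⟨p, hp, rfl⟩ := Finset.mem_image.mp hq
        have hp' := hfin.mem_toFinset.mp hp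
        exact sx_abs k hk n₁ n₂ hn₁ hn₂ Z γ hZ hγ p hp'.1 hp'.2.1 hp'.2.2)
    have hle' : (hfin.toFinset.card : ℝ) ≤
        4 * ((hfin.toFinset.image (fun p : ℤ × ℤ => (p.1.natAbs, p.2.natAbs))).card : ℝ) := by
      exact_mod_cast hle
    linarith
  · rw [hinf.ncard, Nat.cast_zero]
    positivity
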